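/- Let q, p, p' be positive integers with 3 ≤ q ≤ p−2 and p' ≥ p. Let P = (P',P'') be a tuple representing a rational proper map of degree d from the generalized ball D_{q,p} to D_{q+1,p'}, and assume it is fibral-image-preserving: for every Z ∈ D^I_{q,p} there exists W ∈ D^I_{q+1,p'} such that P'(A,AZ)·W = P''(A,AZ) for every row vector A ∈ M(1,q;ℂ) with P(A,AZ) ≠ 0. Then d = 1 (the map is linear), and there exist a generalized unitary matrix Q of signature (q,p), a generalized unitary matrix M of signature (q+1,p') and a scalar c ∈ ℂ∖{0} such that P(z·Q) = c·ι(z)·M for every row vector z ∈ ℂ^{q+p}, where ι(z₁,…,z_q,w₁,…,w_p) := (z₁,…,z_q,0,w₁,…,w_p,0,…,0) ∈ ℂ^{q+1+p'} inserts one zero after the first q entries and p'−p zeros at the end. -/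

import Mathlib

open Matrix
open scoped ComplexOrder

/-- The type-I irreducible bounded symmetric domain `D^I_{m,n}`,
realized as the set of complex `m × n` matrices `Z` with `I - Zᴴ Z` positive definite. -/
def typeIDomain (m n : ℕ) : Set (Matrix (Fin m) (Fin n) ℂ) :=
  {Z | (1 - Zᴴ * Z).PosDef}

/-- `(P1, P2)` represents a rational proper map of degree `d` from the generalized ball
`D_{r,s}` to `D_{r',s'}`: the components are homogeneous polynomials of common degree
`d ≥ 1`, not all zero, with no common non-constant factor, sending (where defined) the
cone over `D_{r,s}` into the cone over `D_{r',s'}` and the boundary cone into the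
boundary cone. -/
def IsRatProperRep (r s r' s' d : ℕ)
    (P1 : Fin r' → MvPolynomial (Fin (r + s)) ℂ)
    (P2 : Fin s' → MvPolynomial (Fin (r + s)) ℂ) : Prop :=
  1 ≤ d ∧
  (∀ i, (P1 i).IsHomogeneous d) ∧
  (∀ j, (P2 j).IsHomogeneous d) ∧
  ¬ ((∀ i, P1 i = 0) ∧ (∀ j, P2 j = 0)) ∧
  (∀ g : MvPolynomial (Fin (r + s)) ℂ,
    (∀ i, g ∣ P1 i) → (∀ j, g ∣ P2 j) → g.totalDegree = 0) ∧
  (∀ (A : Fin r → ℂ) (B : Fin s → ℂ),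
    ∑ j, ‖B j‖ ^ 2 < ∑ i, ‖A i‖ ^ 2 →
    ¬ ((∀ i, MvPolynomial.eval (Fin.append A B) (P1 i) = 0) ∧
       (∀ j, MvPolynomial.eval (Fin.append A B) (P2 j) = 0)) →
    ∑ j, ‖MvPolynomial.eval (Fin.append A B) (P2 j)‖ ^ 2
      < ∑ i, ‖MvPolynomial.eval (Fin.append A B) (P1 i)‖ ^ 2) ∧
  (∀ (A : Fin r → ℂ) (B : Fin s → ℂ), ¬ (A = 0 ∧ B = 0) →
    ∑ i, ‖A i‖ ^ 2 = ∑ j, ‖B j‖ ^ 2 →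
    ¬ ((∀ i, MvPolynomial.eval (Fin.append A B) (P1 i) = 0) ∧
       (∀ j, MvPolynomial.eval (Fin.append A B) (P2 j) = 0)) →
    ∑ i, ‖MvPolynomial.eval (Fin.append A B) (P1 i)‖ ^ 2
      = ∑ j, ‖MvPolynomial.eval (Fin.append A B) (P2 j)‖ ^ 2)

/-- The matrix `I_{m,n} = diag(I_m, -I_n)`. -/
def sigMatrix (m n : ℕ) : Matrix (Fin (m + n)) (Fin (m + n)) ℂ :=
  Matrix.diagonal fun i => if (i : ℕ) < m then 1 else -1

/-- The padding map `ι : ℂ^{r+s} → ℂ^{r'+s'}` sending `(z₁,…,z_r,w₁,…,w_s)` to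
`(z₁,…,z_r,0,…,0,w₁,…,w_s,0,…,0)` with `r'-r` zeros after the first `r` entries and
`s'-s` zeros at the end. -/
def padSig (r s r' s' : ℕ) (z : Fin (r + s) → ℂ) : Fin (r' + s') → ℂ :=
  fun i =>
    if h : (i : ℕ) < r then z ⟨(i : ℕ), by omega⟩
    else if h2 : r' ≤ (i : ℕ) ∧ (i : ℕ) < r' + s then z ⟨(i : ℕ) - r' + r, by omega⟩
    else 0


namespace FIP

open MvPolynomial

/-- One-variable polynomial functions. -/
def PolyFn (f : ℂ → ℂ) : Prop := ∃ p : Polynomial ℂ, ∀ t, f t = p.eval t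

theorem PolyFn.const (c : ℂ) : PolyFn (fun _ => c) := ⟨Polynomial.C c, by simp⟩
theorem PolyFn.id : PolyFn (fun t => t) := ⟨Polynomial.X, by simp⟩
theorem PolyFn.add {f g : ℂ → ℂ} (hf : PolyFn f) (hg : PolyFn g) :
    PolyFn (fun t => f t + g t) := by
  obtain ⟨p, hp⟩ := hf
  obtain ⟨r, hr⟩ := hg
  exact ⟨p + r, fun t => by simp [hp, hr]⟩
theorem PolyFn.mul {f g : ℂ → ℂ} (hf : PolyFn f) (hg : PolyFn g) :
    PolyFn (fun t => f t * g t) := by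
  obtain ⟨p, hp⟩ := hf
  obtain ⟨r, hr⟩ := hg
  exact ⟨p * r, fun t => by simp [hp, hr]⟩
theorem PolyFn.sum {ι : Type*} (s : Finset ι) {f : ι → ℂ → ℂ} (hf : ∀ i ∈ s, PolyFn (f i)) :
    PolyFn (fun t => ∑ i ∈ s, f i t) := by
  classical
  induction s using Finset.induction_on with
  | empty => simpa using PolyFn.const 0
  | insert a s ha ih =>
    simp only [Finset.sum_insert ha]
    exact (hf a (by simp)).add (ih fun i hi => hf i (by simp [hi]))
theorem PolyFn.prod {ι : Type*} (s : Finset ι) {f : ι → ℂ → ℂ} (hf : ∀ i ∈ s, PolyFn (f i)) :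
    PolyFn (fun t => ∏ i ∈ s, f i t) := by
  classical
  induction s using Finset.induction_on with
  | empty => simpa using PolyFn.const 1
  | insert a s ha ih =>
    simp only [Finset.prod_insert ha]
    exact (hf a (by simp)).mul (ih fun i hi => hf i (by simp [hi]))
theorem PolyFn.neg {f : ℂ → ℂ} (hf : PolyFn f) : PolyFn (fun t => - f t) := by
  obtain ⟨p, hp⟩ := hf
  exact ⟨-p, fun t => by simp [hp]⟩
theorem PolyFn.sub {f g : ℂ → ℂ} (hf : PolyFn f) (hg : PolyFn g) :
    PolyFn (fun t => f t - g t) := by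
  simpa [sub_eq_add_neg] using hf.add hg.neg
theorem PolyFn.eval {σ : Type*} (P : MvPolynomial σ ℂ) {x : ℂ → σ → ℂ}
    (hx : ∀ i, PolyFn (fun t => x t i)) : PolyFn (fun t => MvPolynomial.eval (x t) P) := by
  choose p hp using hx
  refine ⟨MvPolynomial.aeval p P, fun t => ?_⟩
  induction P using MvPolynomial.induction_on with
  | C a => simp
  | add P R h1 h2 => simp [h1, h2]
  | mul_X P i h => simp [h, hp]
theorem PolyFn.det {ι : Type*} [Fintype ι] [DecidableEq ι] {M : ℂ → Matrix ι ι ℂ}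
    (hM : ∀ i j, PolyFn (fun t => M t i j)) : PolyFn (fun t => (M t).det) := by
  simp only [Matrix.det_apply']
  exact PolyFn.sum _ fun σ _ => (PolyFn.const _).mul (PolyFn.prod _ fun i _ => hM _ _)
theorem PolyFn.finite_zeros {f : ℂ → ℂ} (hf : PolyFn f) {t₀ : ℂ} (h : f t₀ ≠ 0) :
    {t | f t = 0}.Finite := by
  obtain ⟨p, hp⟩ := hf
  have hp0 : p ≠ 0 := by
    rintro rfl
    exact h (by simp [hp])
  refine (p.roots.toFinset.finite_toSet).subset fun t ht => ?_
  simp only [Set.mem_ofPred_eq] at ht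
  simp [hp0, Polynomial.IsRoot, ← hp, ht]
theorem PolyFn.eq_zero {f : ℂ → ℂ} (hf : PolyFn f) (h : {t | f t = 0}.Infinite) (t : ℂ) :
    f t = 0 := by
  by_contra h0
  exact h (hf.finite_zeros h0)

/-- Polynomial functions of a matrix (tested along polynomial curves). -/
def PF {α β : Type*} (Ψ : Matrix α β ℂ → ℂ) : Prop :=
  ∀ M : ℂ → Matrix α β ℂ, (∀ i j, PolyFn (fun t => M t i j)) → PolyFn (fun t => Ψ (M t))

theorem PF.mul {α β : Type*} {Ψ Θ : Matrix α β ℂ → ℂ} (h1 : PF Ψ) (h2 : PF Θ) :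
    PF (fun M => Ψ M * Θ M) := fun M hM => (h1 M hM).mul (h2 M hM)

theorem PF.line {α β : Type*} {Ψ : Matrix α β ℂ → ℂ} (h : PF Ψ) (A B : Matrix α β ℂ) :
    PolyFn (fun t => Ψ (A + t • B)) :=
  h _ fun i j => by
    simp only [Matrix.add_apply, Matrix.smul_apply, smul_eq_mul]
    exact (PolyFn.const _).add (PolyFn.id.mul (PolyFn.const _))

theorem PF.mul_ne {α β : Type*} {Ψ Θ : Matrix α β ℂ → ℂ} (h1 : PF Ψ) (h2 : PF Θ)
    (e1 : ∃ M, Ψ M ≠ 0) (e2 : ∃ M, Θ M ≠ 0) : ∃ M, Ψ M * Θ M ≠ 0 := by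
  obtain ⟨A, hA⟩ := e1
  obtain ⟨B, hB⟩ := e2
  have l1 := (h1.line A (B - A)).finite_zeros (t₀ := 0) (by simpa using hA)
  have l2 := (h2.line A (B - A)).finite_zeros (t₀ := 1) (by simpa using hB)
  obtain ⟨t, ht⟩ := (l1.union l2).exists_notMem
  simp only [Set.mem_union, Set.mem_ofPred_eq, not_or] at ht
  exact ⟨_, mul_ne_zero ht.1 ht.2⟩

theorem PF.prod {ι α β : Type*} (s : Finset ι) {Ψ : ι → Matrix α β ℂ → ℂ}
    (h : ∀ i ∈ s, PF (Ψ i)) : PF (fun M => ∏ i ∈ s, Ψ i M) :=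
  fun M hM => PolyFn.prod s fun i hi => h i hi M hM

theorem PF.prod_ne {ι α β : Type*} (s : Finset ι) {Ψ : ι → Matrix α β ℂ → ℂ}
    (h : ∀ i ∈ s, PF (Ψ i)) (e : ∀ i ∈ s, ∃ M, Ψ i M ≠ 0) : ∃ M, ∏ i ∈ s, Ψ i M ≠ 0 := by
  classical
  induction s using Finset.induction_on with
  | empty => exact ⟨0, by simp⟩
  | insert a s ha ih =>
    simp only [Finset.prod_insert ha]
    exact PF.mul_ne (h a (by simp)) (PF.prod s fun i hi => h i (by simp [hi])) (e a (by simp))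
      (ih (fun i hi => h i (by simp [hi])) (fun i hi => e i (by simp [hi])))

/-- Signs. -/
def eps (m n : ℕ) (i : Fin (m + n)) : ℂ := if (i : ℕ) < m then 1 else -1

/-- The Hermitian form of signature `(m,n)`. -/
def hm (m n : ℕ) (z w : Fin (m + n) → ℂ) : ℂ := ∑ i, eps m n i * z i * star (w i)

theorem eps_mul_self (m n : ℕ) (i : Fin (m + n)) : eps m n i * eps m n i = 1 := by
  unfold eps; split_ifs <;> simp
theorem star_eps (m n : ℕ) (i : Fin (m + n)) : star (eps m n i) = eps m n i := by
  unfold eps; split_ifs <;> simp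
theorem eps_ne (m n : ℕ) (i : Fin (m + n)) : eps m n i ≠ 0 := by
  unfold eps; split_ifs <;> simp

section
variable {m n : ℕ}
theorem hm_add_left (x y w : Fin (m + n) → ℂ) : hm m n (x + y) w = hm m n x w + hm m n y w := by
  simp [hm, ← Finset.sum_add_distrib, mul_add, add_mul]
theorem hm_add_right (w x y : Fin (m + n) → ℂ) : hm m n w (x + y) = hm m n w x + hm m n w y := by
  simp [hm, ← Finset.sum_add_distrib, mul_add]
theorem hm_smul_left (c : ℂ) (x w : Fin (m + n) → ℂ) : hm m n (c • x) w = c * hm m n x w := by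
  simp only [hm, Finset.mul_sum, Pi.smul_apply, smul_eq_mul]
  exact Finset.sum_congr rfl fun i _ => by ring
theorem hm_smul_right (c : ℂ) (x w : Fin (m + n) → ℂ) :
    hm m n x (c • w) = star c * hm m n x w := by
  simp only [hm, Finset.mul_sum, Pi.smul_apply, smul_eq_mul, star_mul']
  exact Finset.sum_congr rfl fun i _ => by ring
theorem hm_star (x y : Fin (m + n) → ℂ) : star (hm m n x y) = hm m n y x := by
  simp only [hm, star_sum, star_mul', star_star, star_eps]
  exact Finset.sum_congr rfl fun i _ => by ring
theorem hm_symm_zero {x y : Fin (m + n) → ℂ} (h : hm m n x y = 0) : hm m n y x = 0 := by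
  rw [← hm_star, h, star_zero]
@[simp] theorem hm_zero_left (y : Fin (m + n) → ℂ) : hm m n 0 y = 0 := by simp [hm]
@[simp] theorem hm_zero_right (y : Fin (m + n) → ℂ) : hm m n y 0 = 0 := by simp [hm]
theorem hm_sum_left {ι : Type*} (s : Finset ι) (f : ι → Fin (m + n) → ℂ) (w : Fin (m + n) → ℂ) :
    hm m n (∑ i ∈ s, f i) w = ∑ i ∈ s, hm m n (f i) w := by
  classical
  induction s using Finset.induction_on with
  | empty => simp
  | insert a s ha ih => simp [Finset.sum_insert ha, hm_add_left, ih]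
theorem hm_self_im (x : Fin (m + n) → ℂ) : (hm m n x x).im = 0 := by
  have := congrArg Complex.im (hm_star x x)
  simp at this
  linarith
theorem hm_self (x : Fin (m + n) → ℂ) : hm m n x x = ((hm m n x x).re : ℂ) := by
  apply Complex.ext <;> simp [hm_self_im]
theorem hm_self_append (A : Fin m → ℂ) (B : Fin n → ℂ) :
    (hm m n (Fin.append A B) (Fin.append A B)).re = ∑ i, ‖A i‖ ^ 2 - ∑ j, ‖B j‖ ^ 2 := by
  have key : ∀ z : ℂ, (z * (starRingEnd ℂ) z).re = ‖z‖ ^ 2 := fun z => by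
    rw [Complex.mul_conj, Complex.ofReal_re, Complex.normSq_eq_norm_sq]
  simp [hm, Fin.sum_univ_add, eps, sub_eq_add_neg, key, - Complex.mul_re]
/-- left-linear functional -/
def hmL (w : Fin (m + n) → ℂ) : (Fin (m + n) → ℂ) →ₗ[ℂ] ℂ where
  toFun z := hm m n z w
  map_add' x y := hm_add_left x y w
  map_smul' c x := hm_smul_left c x w
theorem append_split (z : Fin (m + n) → ℂ) :
    Fin.append (fun i => z (Fin.castAdd n i)) (fun j => z (Fin.natAdd m j)) = z := by
  ext i
  refine Fin.addCases (fun i => ?_) (fun i => ?_) i <;> simp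
end

/-- Evaluate a tuple of polynomials. -/
noncomputable def ev {τ σ : Type*} (P : τ → MvPolynomial σ ℂ) (z : σ → ℂ) : τ → ℂ := fun t => eval z (P t)

theorem eval_smul_hom {N d : ℕ} {P : MvPolynomial (Fin N) ℂ} (h : P.IsHomogeneous d) (c : ℂ)
    (x : Fin N → ℂ) : eval (c • x) P = c ^ d * eval x P := by
  rw [eval_eq, eval_eq, Finset.mul_sum]
  refine Finset.sum_congr rfl fun e he => ?_
  have hd : ∑ i ∈ e.support, e i = d := by
    have := h (mem_support_iff.mp he)
    simpa [Finsupp.weight_apply, Finsupp.sum] using this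
  rw [← hd, ← Finset.prod_pow_eq_pow_sum]
  simp only [Pi.smul_apply, smul_eq_mul, mul_pow, Finset.prod_mul_distrib]
  ring

theorem eval_conj {N : ℕ} (P : MvPolynomial (Fin N) ℂ) (x : Fin N → ℂ) :
    eval (star x) (map (starRingEnd ℂ) P) = star (eval x P) := by
  induction P using MvPolynomial.induction_on with
  | C a => simp
  | add P R h1 h2 => simp [h1, h2]
  | mul_X P i h => simp [h]

theorem ev_smul {N d : ℕ} {τ : Type*} {P : τ → MvPolynomial (Fin N) ℂ}
    (h : ∀ t, (P t).IsHomogeneous d) (c : ℂ) (x : Fin N → ℂ) :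
    ev P (c • x) = c ^ d • ev P x := by
  ext t
  simp [ev, eval_smul_hom (h t)]

theorem circle_infinite : {z : ℂ | ‖z‖ = 1}.Infinite := by
  have hinj : Set.InjOn (fun t : ℝ => (⟨t, Real.sqrt (1 - t ^ 2)⟩ : ℂ)) (Set.Ioo (0:ℝ) 1) := by
    intro a _ b _ hab
    exact congrArg Complex.re hab
  refine ((Set.Ioo_infinite (by norm_num : (0:ℝ) < 1)).image hinj).mono ?_
  rintro _ ⟨t, ht, rfl⟩
  have h1 : 0 ≤ 1 - t ^ 2 := by nlinarith [ht.1, ht.2]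
  have h2 := Real.sq_sqrt h1
  have h3 : ‖(⟨t, Real.sqrt (1 - t ^ 2)⟩ : ℂ)‖ ^ 2 = 1 := by
    rw [← Complex.normSq_eq_norm_sq, Complex.normSq_mk]
    nlinarith
  have h4 := norm_nonneg (⟨t, Real.sqrt (1 - t ^ 2)⟩ : ℂ)
  simp only [Set.mem_ofPred_eq]
  nlinarith

theorem real_infinite (R : ℝ) : {z : ℂ | ∃ s : ℝ, R < s ∧ z = s}.Infinite := by
  refine ((Set.Ioi_infinite R).image (Complex.ofReal_injective.injOn)).mono ?_
  rintro _ ⟨s, hs, rfl⟩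
  exact ⟨s, hs, rfl⟩

section E
variable {q p m n d : ℕ} {P : Fin (m + n) → MvPolynomial (Fin (q + p)) ℂ}

theorem orth_neg (hh : ∀ t, (P t).IsHomogeneous d)
    (hB : ∀ z, hm q p z z = 0 → hm m n (ev P z) (ev P z) = 0)
    (z w : Fin (q + p) → ℂ) (h1 : hm q p z w = 0) (h2 : hm q p w w = - hm q p z z) :
    hm m n (ev P z) (ev P w) = 0 := by
  have h1' := hm_symm_zero h1
  have key : PolyFn (fun ζ => ∑ i, eps m n i * eval (z + ζ • w) (P i) *
      eval (ζ • star z + star w) (map (starRingEnd ℂ) (P i))) := by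
    refine PolyFn.sum _ fun i _ => ((PolyFn.const _).mul (PolyFn.eval _ fun j => ?_)).mul
      (PolyFn.eval _ fun j => ?_)
    · simp only [Pi.add_apply, Pi.smul_apply, smul_eq_mul]
      exact (PolyFn.const _).add (PolyFn.id.mul (PolyFn.const _))
    · simp only [Pi.add_apply, Pi.smul_apply, smul_eq_mul]
      exact (PolyFn.id.mul (PolyFn.const _)).add (PolyFn.const _)
  have h0 := key.eq_zero (circle_infinite.mono fun ζ hζ => ?_) 0
  · simp only [zero_smul, add_zero, zero_add, eval_conj] at h0
    exact h0
  · simp only [Set.mem_ofPred_eq] at hζ ⊢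
    have hζ1 : ζ * star ζ = 1 := by
      have := Complex.mul_conj ζ
      rw [Complex.normSq_eq_norm_sq, hζ] at this
      simpa using this
    have e1 : ζ • star z + star w = ζ • star (z + ζ • w) := by
      ext j
      simp only [Pi.add_apply, Pi.smul_apply, smul_eq_mul, Pi.star_apply, star_add, star_mul']
      linear_combination (- star (w j)) * hζ1
    have hnull : hm q p (z + ζ • w) (z + ζ • w) = 0 := by
      simp only [hm_add_left, hm_add_right, hm_smul_left, hm_smul_right, h1, h1', h2]
      linear_combination (- hm q p z z) * hζ1
    have h3 := hB _ hnull
    simp only [e1]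
    have : ∀ i, eval (ζ • star (z + ζ • w)) (map (starRingEnd ℂ) (P i)) =
        ζ ^ d * star (eval (z + ζ • w) (P i)) := fun i => by
      rw [eval_smul_hom ((hh i).map _), eval_conj]
    simp only [this]
    have h4 : ζ ^ d * hm m n (ev P (z + ζ • w)) (ev P (z + ζ • w)) = 0 := by rw [h3, mul_zero]
    rw [← h4, hm, Finset.mul_sum]
    exact Finset.sum_congr rfl fun i _ => by simp only [ev]; ring

theorem exists_neg_perp (hp : 2 ≤ p) (z : Fin (q + p) → ℂ) :
    ∃ w, hm q p z w = 0 ∧ (hm q p w w).re = -1 := by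
  obtain ⟨i0, i1, hne⟩ : ∃ i0 i1 : Fin p, i0 ≠ i1 :=
    ⟨⟨0, by omega⟩, ⟨1, by omega⟩, by simp⟩
  suffices ∃ w, hm q p z w = 0 ∧ (hm q p w w).re < 0 by
    obtain ⟨w, h1, h2⟩ := this
    refine ⟨(((Real.sqrt (-(hm q p w w).re))⁻¹ : ℝ) : ℂ) • w, by rw [hm_smul_right, h1, mul_zero], ?_⟩
    rw [hm_smul_left, hm_smul_right]
    have h3 : Real.sqrt (-(hm q p w w).re) ^ 2 = -(hm q p w w).re := Real.sq_sqrt (by linarith)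
    have h4 : Real.sqrt (-(hm q p w w).re) ≠ 0 := by
      intro h; rw [h] at h3; norm_num at h3; linarith
    rw [Complex.star_def, Complex.conj_ofReal, Complex.re_ofReal_mul, Complex.re_ofReal_mul]
    field_simp
    linarith
  set b0 := z (Fin.natAdd q i0)
  set b1 := z (Fin.natAdd q i1)
  by_cases hb : b0 = 0
  · refine ⟨Fin.append 0 (Pi.single i0 1), ?_, ?_⟩
    · simp [hm, Fin.sum_univ_add, Pi.single_apply]
      right; exact hb
    · rw [hm_self_append]
      have : 0 < ∑ j, ‖(Pi.single i0 1 : Fin p → ℂ) j‖ ^ 2 :=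
        Finset.sum_pos' (fun _ _ => by positivity) ⟨i0, Finset.mem_univ _, by simp⟩
      simp only [Pi.zero_apply, norm_zero]
      simp at this ⊢
      linarith
  · refine ⟨Fin.append 0 (Pi.single i0 (star b1) - Pi.single i1 (star b0)), ?_, ?_⟩
    · simp only [hm, Fin.sum_univ_add, Fin.append_left, Fin.append_right, Pi.zero_apply, star_zero,
        mul_zero, Finset.sum_const_zero, zero_add, Pi.sub_apply, star_sub, mul_sub,
        Finset.sum_sub_distrib, Pi.single_apply, apply_ite star, star_star, mul_ite,
        Finset.sum_ite_eq', Finset.mem_univ, if_true]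
      simp [eps, b0, b1]; ring
    · rw [hm_self_append]
      have : 0 < ∑ j, ‖(Pi.single i0 (star b1) - Pi.single i1 (star b0) : Fin p → ℂ) j‖ ^ 2 :=
        Finset.sum_pos' (fun _ _ => by positivity) ⟨i1, Finset.mem_univ _, by
          simp [hne.symm]; positivity⟩
      have h0 : ∑ i : Fin q, ‖(0 : Fin q → ℂ) i‖ ^ 2 = 0 := by simp
      rw [h0]; linarith

theorem orth (hp : 2 ≤ p) (hh : ∀ t, (P t).IsHomogeneous d)
    (hB : ∀ z, hm q p z z = 0 → hm m n (ev P z) (ev P z) = 0)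
    (z w : Fin (q + p) → ℂ) (hz : 0 < (hm q p z z).re) (h1 : hm q p z w = 0) :
    hm m n (ev P w) (ev P z) = 0 := by
  -- negative case
  have step : ∀ w, hm q p z w = 0 → (hm q p w w).re < 0 → hm m n (ev P w) (ev P z) = 0 := by
    intro w h1 hw
    set a := (hm q p z z).re
    set b := (hm q p w w).re
    have hr : 0 < -a / b := div_pos_of_neg_of_neg (by linarith) hw
    set r := Real.sqrt (-a / b)
    have hr2 : r ^ 2 = -a / b := Real.sq_sqrt hr.le
    have hr0 : r ≠ 0 := by
      intro h; rw [← hr2, h] at hr; norm_num at hr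
    have h3 := orth_neg (P := P) hh hB z ((r : ℂ) • w) (by rw [hm_smul_right, h1, mul_zero]) (by
      rw [hm_smul_left, hm_smul_right, hm_self w, hm_self z, Complex.star_def, Complex.conj_ofReal]
      norm_cast
      have : b ≠ 0 := hw.ne
      change r * (r * b) = -a
      have : r * (r * b) = r ^ 2 * b := by ring
      rw [this, hr2]; field_simp)
    rw [ev_smul hh, hm_smul_right] at h3
    refine hm_symm_zero ((mul_eq_zero.mp h3).resolve_left ?_)
    simp [hr0]
  obtain ⟨v, hv1, hv2⟩ := exists_neg_perp hp z
  have key : PolyFn (fun s => hm m n (ev P (s • v + w)) (ev P z)) := by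
    unfold hm ev
    refine PolyFn.sum _ fun i _ => ((PolyFn.const _).mul (PolyFn.eval _ fun j => ?_)).mul
      (PolyFn.const _)
    simp only [Pi.add_apply, Pi.smul_apply, smul_eq_mul]
    exact (PolyFn.id.mul (PolyFn.const _)).add (PolyFn.const _)
  set C := ‖hm q p v w + hm q p w v‖ + |(hm q p w w).re| + 1 with hC
  have h0 := key.eq_zero ((real_infinite C).mono fun s hs => ?_) 0
  · simpa using h0
  · obtain ⟨s, hs, rfl⟩ := hs
    simp only [Set.mem_ofPred_eq]
    refine step _ ?_ ?_
    · rw [hm_add_right, hm_smul_right, hv1, h1]; simp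
    · have e : hm q p ((s : ℂ) • v + w) ((s : ℂ) • v + w) =
        s * s * hm q p v v + s * (hm q p v w + hm q p w v) + hm q p w w := by
        simp only [hm_add_left, hm_add_right, hm_smul_left, hm_smul_right, Complex.star_def,
          Complex.conj_ofReal]
        ring
      rw [e]
      have h5 : (hm q p v w + hm q p w v).re ≤ ‖hm q p v w + hm q p w v‖ := Complex.re_le_norm _
      have h6 := le_abs_self (hm q p w w).re
      have h7 := abs_nonneg (hm q p w w).re
      have h8 := norm_nonneg (hm q p v w + hm q p w v)
      have h9 : (s * s * hm q p v v + s * (hm q p v w + hm q p w v) + hm q p w w : ℂ).re =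
        s * s * (hm q p v v).re + s * (hm q p v w + hm q p w v).re + (hm q p w w).re := by
        simp [Complex.add_re, Complex.mul_re]
      rw [h9, hv2]
      have hs0 : 0 < s := by linarith
      nlinarith [mul_le_mul_of_nonneg_left h5 hs0.le]
end E

/-- Squared Euclidean norm. -/
noncomputable def nsq {ι : Type*} [Fintype ι] (x : ι → ℂ) : ℝ := ∑ i, ‖x i‖ ^ 2

theorem nsq_nonneg {ι : Type*} [Fintype ι] (x : ι → ℂ) : 0 ≤ nsq x :=
  Finset.sum_nonneg fun _ _ => by positivity
theorem nsq_pos {ι : Type*} [Fintype ι] {x : ι → ℂ} (h : x ≠ 0) : 0 < nsq x := by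
  obtain ⟨i, hi⟩ := Function.ne_iff.mp h
  refine Finset.sum_pos' (fun _ _ => by positivity) ⟨i, Finset.mem_univ _, ?_⟩
  have : 0 < ‖x i‖ := norm_pos_iff.mpr hi
  positivity
theorem nsq_eq {ι : Type*} [Fintype ι] (x : ι → ℂ) : star x ⬝ᵥ x = ((nsq x : ℝ) : ℂ) := by
  simp only [nsq, dotProduct, Pi.star_apply, Complex.ofReal_sum]
  refine Finset.sum_congr rfl fun i _ => ?_
  rw [Complex.star_def, mul_comm, Complex.mul_conj, Complex.normSq_eq_norm_sq]
theorem nsq_cs {ι : Type*} [Fintype ι] (x y : ι → ℂ) : ‖x ⬝ᵥ y‖ ^ 2 ≤ nsq x * nsq y := by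
  have h1 : ‖x ⬝ᵥ y‖ ≤ ∑ i, ‖x i‖ * ‖y i‖ := by
    refine (norm_sum_le _ _).trans (Finset.sum_le_sum fun i _ => (norm_mul _ _).le)
  refine le_trans ?_ (Finset.sum_mul_sq_le_sq_mul_sq _ _ _)
  exact pow_le_pow_left₀ (norm_nonneg _) h1 2
theorem nsq_star {ι : Type*} [Fintype ι] (x : ι → ℂ) : nsq (star x) = nsq x := by
  simp [nsq]

theorem contract_transpose {m n : ℕ} (Z : Matrix (Fin m) (Fin n) ℂ)
    (h : ∀ x, x ≠ 0 → nsq (Z *ᵥ x) < nsq x) (x : Fin m → ℂ) (hx : x ≠ 0) :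
    nsq (x ᵥ* Z) < nsq x := by
  by_cases hy : x ᵥ* Z = 0
  · rw [hy]; simpa [nsq] using nsq_pos hx
  have hy' : star (x ᵥ* Z) ≠ 0 := by simpa using hy
  have h1 := h _ hy'
  have h2 := nsq_cs x (Z *ᵥ star (x ᵥ* Z))
  rw [dotProduct_mulVec, dotProduct_comm, nsq_eq, Complex.norm_real, Real.norm_eq_abs,
    sq_abs] at h2
  rw [nsq_star] at h1
  have h3 := nsq_pos hy
  have h4 := nsq_pos hx
  nlinarith

theorem typeI_iff {m n : ℕ} (Z : Matrix (Fin m) (Fin n) ℂ) :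
    Z ∈ typeIDomain m n ↔ ∀ x, x ≠ 0 → nsq (x ᵥ* Z) < nsq x := by
  have key : Z ∈ typeIDomain m n ↔ ∀ x, x ≠ 0 → nsq (Z *ᵥ x) < nsq x := by
    have e : ∀ x, star x ⬝ᵥ ((1 - Zᴴ * Z) *ᵥ x) = ((nsq x - nsq (Z *ᵥ x) : ℝ) : ℂ) := by
      intro x
      rw [sub_mulVec, one_mulVec, dotProduct_sub, nsq_eq, ← mulVec_mulVec, dotProduct_mulVec,
        ← star_mulVec, nsq_eq]
      push_cast; rfl
    constructor
    · intro h x hx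
      have := (posDef_iff_dotProduct_mulVec.mp h).2 hx
      rw [e] at this
      have := Complex.zero_lt_real.mp this
      linarith
    · intro h
      refine posDef_iff_dotProduct_mulVec.mpr ⟨?_, fun x hx => ?_⟩
      · simp [Matrix.IsHermitian, conjTranspose_sub, conjTranspose_mul]
      · rw [e]
        exact Complex.zero_lt_real.mpr (by linarith [h x hx])
  rw [key]
  refine ⟨contract_transpose Z, fun h x hx => ?_⟩
  have := contract_transpose Zᵀ (fun y hy => by simpa [mulVec_transpose] using h y hy) x hx
  simpa [vecMul_transpose] using this

/-- positive definite subspace -/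
def Pos {m n : ℕ} (E : Submodule ℂ (Fin (m + n) → ℂ)) : Prop :=
  ∀ x ∈ E, x ≠ 0 → 0 < (hm m n x x).re

theorem hm_re_append {m n : ℕ} (A : Fin m → ℂ) (B : Fin n → ℂ) :
    (hm m n (Fin.append A B) (Fin.append A B)).re = nsq A - nsq B := hm_self_append A B

theorem fibral {q p m n : ℕ} (P1 : Fin m → MvPolynomial (Fin (q + p)) ℂ)
    (P2 : Fin n → MvPolynomial (Fin (q + p)) ℂ)
    (hfip : ∀ Z ∈ typeIDomain q p, ∃ W ∈ typeIDomain m n,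
      ∀ A : Fin q → ℂ,
        ¬ ((∀ i, MvPolynomial.eval (Fin.append A (A ᵥ* Z)) (P1 i) = 0) ∧
           (∀ j, MvPolynomial.eval (Fin.append A (A ᵥ* Z)) (P2 j) = 0)) →
        (fun i => MvPolynomial.eval (Fin.append A (A ᵥ* Z)) (P1 i)) ᵥ* W
          = fun j => MvPolynomial.eval (Fin.append A (A ᵥ* Z)) (P2 j))
    (E : Submodule ℂ (Fin (q + p) → ℂ)) (hE : Pos E) (hfr : Module.finrank ℂ E = q) :
    ∃ U : Submodule ℂ (Fin (m + n) → ℂ), Pos U ∧ Module.finrank ℂ U ≤ m ∧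
      ∀ x ∈ E, ev (Fin.append P1 P2) x ∈ U := by
  set f : E →ₗ[ℂ] (Fin q → ℂ) :=
    (LinearMap.funLeft ℂ ℂ (Fin.castAdd p)).comp E.subtype with hf
  set g : E →ₗ[ℂ] (Fin p → ℂ) :=
    (LinearMap.funLeft ℂ ℂ (Fin.natAdd q)).comp E.subtype with hg
  have hsplit : ∀ x : E, (x : Fin (q + p) → ℂ) = Fin.append (f x) (g x) := fun x =>
    (append_split (x : Fin (q + p) → ℂ)).symm
  have hinj : Function.Injective f := by
    rw [injective_iff_map_eq_zero]
    intro x hx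
    by_contra hne
    have h1 := hE x x.2 (by simpa using hne)
    rw [hsplit x, hm_re_append, hx] at h1
    have h2 := nsq_nonneg (g x)
    simp [nsq] at h1 h2
    linarith
  set e := LinearEquiv.ofInjectiveOfFinrankEq f hinj (by rw [hfr]; simp) with he
  have hfe : ∀ A, f (e.symm A) = A := fun A => e.apply_symm_apply A
  set Z : Matrix (Fin q) (Fin p) ℂ := (LinearMap.toMatrix' (g.comp e.symm.toLinearMap))ᵀ with hZ
  have hAZ : ∀ A, A ᵥ* Z = g (e.symm A) := by
    intro A
    rw [hZ, vecMul_transpose, ← Matrix.toLin'_apply, Matrix.toLin'_toMatrix']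
    rfl
  have hZm : Z ∈ typeIDomain q p := by
    rw [typeI_iff]
    intro A hA
    have h1 := hE (e.symm A) (e.symm A).2 (by simpa using hA)
    rw [hsplit, hm_re_append, hfe] at h1
    rw [hAZ]; linarith
  obtain ⟨W, hW, hPW⟩ := hfip Z hZm
  rw [typeI_iff] at hW
  let Lp : (Fin m → ℂ) →ₗ[ℂ] (Fin (m + n) → ℂ) :=
    { toFun := fun x => Fin.append x (x ᵥ* W)
      map_add' := fun x y => by
        ext i
        refine Fin.addCases (fun i => ?_) (fun i => ?_) i <;> simp [add_vecMul]
      map_smul' := fun c x => by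
        ext i
        refine Fin.addCases (fun i => ?_) (fun i => ?_) i <;> simp [smul_vecMul] }
  refine ⟨LinearMap.range Lp, ?_, ?_, ?_⟩
  · rintro _ ⟨x, rfl⟩ hne
    change 0 < (hm m n (Fin.append x (x ᵥ* W)) (Fin.append x (x ᵥ* W))).re
    rw [hm_re_append]
    have : x ≠ 0 := by rintro rfl; exact hne (map_zero _)
    linarith [hW x this]
  · simpa using LinearMap.finrank_range_le Lp
  · intro x hx
    have h1 := hsplit ⟨x, hx⟩
    have h2 : g ⟨x, hx⟩ = (f ⟨x, hx⟩) ᵥ* Z := by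
      rw [hAZ]
      exact congrArg g (e.symm_apply_apply ⟨x, hx⟩).symm
    rw [h2] at h1
    set A := f ⟨x, hx⟩
    by_cases h0 : ((∀ i, MvPolynomial.eval (Fin.append A (A ᵥ* Z)) (P1 i) = 0) ∧
           (∀ j, MvPolynomial.eval (Fin.append A (A ᵥ* Z)) (P2 j) = 0))
    · have : ev (Fin.append P1 P2) x = 0 := by
        ext i
        simp only at h1
        rw [ev, h1]
        refine Fin.addCases (fun i => ?_) (fun i => ?_) i <;> simp [h0.1, h0.2]
      rw [this]; exact Submodule.zero_mem _
    · refine ⟨fun i => MvPolynomial.eval (Fin.append A (A ᵥ* Z)) (P1 i), ?_⟩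
      have e0 : ∀ y, Lp y = Fin.append y (y ᵥ* W) := fun y => rfl
      rw [e0, hPW A h0]
      ext i
      simp only at h1
      rw [ev, h1]
      refine Fin.addCases (fun i => ?_) (fun i => ?_) i <;> simp

theorem det_dep {ι : Type*} [Fintype ι] [DecidableEq ι] {N : ℕ} {v : ι → Fin N → ℂ}
    (h : ¬ LinearIndependent ℂ v) (Φ : ι → (Fin N → ℂ) →ₗ[ℂ] ℂ) :
    (Matrix.of fun a b => Φ b (v a)).det = 0 := by
  rw [Fintype.not_linearIndependent_iff] at h
  obtain ⟨c, hc, i, hi⟩ := h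
  rw [← Matrix.exists_vecMul_eq_zero_iff]
  refine ⟨c, fun h => hi (by rw [h]; rfl), ?_⟩
  ext b
  have := congrArg (Φ b) hc
  simpa [vecMul, dotProduct] using this

theorem det_indep {ι : Type*} [Fintype ι] [DecidableEq ι] {N : ℕ} {v : ι → Fin N → ℂ}
    (h : LinearIndependent ℂ v) : ∃ Φ : ι → (Fin N → ℂ) →ₗ[ℂ] ℂ,
    (Matrix.of fun a b => Φ b (v a)).det ≠ 0 := by
  have hinj : LinearMap.ker (Fintype.linearCombination ℂ v) = ⊥ := by
    rw [LinearMap.ker_eq_bot]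
    exact h.fintypeLinearCombination_injective
  obtain ⟨g, hg⟩ := LinearMap.exists_leftInverse_of_injective _ hinj
  refine ⟨fun b => (LinearMap.proj b).comp g, ?_⟩
  have : (Matrix.of fun a b => ((LinearMap.proj b).comp g) (v a) : Matrix ι ι ℂ) = 1 := by
    ext a b
    have h1 := congrArg (fun l => l (Pi.single a 1)) hg
    simp only [LinearMap.comp_apply, Fintype.linearCombination_apply_single, one_smul,
      LinearMap.id_apply] at h1
    simp [h1, Matrix.one_apply, Pi.single_apply, eq_comm]
  rw [this]; simp

theorem PolyFn.linear {N : ℕ} {x : ℂ → Fin N → ℂ} (hx : ∀ i, PolyFn (fun t => x t i))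
    (φ : (Fin N → ℂ) →ₗ[ℂ] ℂ) : PolyFn (fun t => φ (x t)) := by
  have : ∀ t, φ (x t) = ∑ i, x t i * φ (Pi.single i 1) := by
    intro t
    conv_lhs => rw [← Finset.univ_sum_single (x t)]
    rw [map_sum]
    refine Finset.sum_congr rfl fun i _ => ?_
    have : (Pi.single i (x t i) : Fin N → ℂ) = x t i • Pi.single i 1 := by
      rw [← Pi.single_smul]; simp
    rw [this, map_smul, smul_eq_mul]
  simp only [this]
  exact PolyFn.sum _ fun i _ => (hx i).mul (PolyFn.const _)

theorem pos_dep {m n : ℕ} {ι : Type*} [Fintype ι] {U : Submodule ℂ (Fin (m + n) → ℂ)} {r : ℕ}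
    (hU : Module.finrank ℂ U ≤ r) (hr : r < Fintype.card ι) {v : ι → Fin (m + n) → ℂ}
    (hv : ∀ i, v i ∈ U) : ¬ LinearIndependent ℂ v := by
  intro h
  have h1 : LinearIndependent ℂ (fun i => (⟨v i, hv i⟩ : U)) :=
    LinearIndependent.of_comp U.subtype h
  have := h1.fintype_card_le_finrank
  omega

theorem hm_cs {m n : ℕ} (x y : Fin (m + n) → ℂ) : ‖hm m n x y‖ ^ 2 ≤ nsq x * nsq y := by
  have h := nsq_cs (fun i => eps m n i * x i) (star y)
  have e1 : nsq (fun i => eps m n i * x i) = nsq x := by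
    refine Finset.sum_congr rfl fun i _ => ?_
    rw [norm_mul]
    have : ‖eps m n i‖ = 1 := by unfold eps; split_ifs <;> simp
    rw [this, one_mul]
  rw [e1, nsq_star] at h
  exact h

/-- the standard first vectors -/
def stdv (q p : ℕ) (i : Fin q) : Fin (q + p) → ℂ := Fin.append (Pi.single i 1) 0

theorem sum_stdv {q p : ℕ} (a : Fin q → ℂ) : ∑ i, a i • stdv q p i = Fin.append a 0 := by
  ext j
  rw [Finset.sum_apply]
  refine Fin.addCases (fun j => ?_) (fun j => ?_) j <;> simp [stdv, Pi.single_apply]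

theorem nsq_comb {q N : ℕ} (Y : Fin q → Fin N → ℂ) : ∃ K : ℝ, 0 ≤ K ∧
    ∀ a : Fin q → ℂ, nsq (∑ i, a i • Y i) ≤ K * nsq a := by
  refine ⟨∑ k, nsq (fun i => Y i k), Finset.sum_nonneg fun _ _ => nsq_nonneg _, fun a => ?_⟩
  rw [Finset.sum_mul]
  refine Finset.sum_le_sum fun k _ => ?_
  have := nsq_cs a (fun i => Y i k)
  simp only [Finset.sum_apply, Pi.smul_apply, smul_eq_mul]
  rw [mul_comm]
  exact this

theorem small_pos {q p : ℕ} (Y : Fin q → Fin (q + p) → ℂ) : ∃ δ : ℝ, 0 < δ ∧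
    ∀ t : ℝ, 0 < t → t < δ → ∀ a : Fin q → ℂ, a ≠ 0 →
      0 < (hm q p (∑ i, a i • (stdv q p i + (t : ℂ) • Y i))
        (∑ i, a i • (stdv q p i + (t : ℂ) • Y i))).re := by
  obtain ⟨K, hK, hY⟩ := nsq_comb Y
  refine ⟨1 / (4 * (1 + K)), by positivity, fun t ht htd a ha => ?_⟩
  set y := ∑ i, a i • Y i with hy
  set x : Fin (q + p) → ℂ := Fin.append a 0
  have e : ∑ i, a i • (stdv q p i + (t : ℂ) • Y i) = x + (t : ℂ) • y := by
    simp only [smul_add, Finset.sum_add_distrib, sum_stdv, hy, Finset.smul_sum, x]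
    congr 1
    exact Finset.sum_congr rfl fun i _ => smul_comm _ _ _
  rw [e]
  have hx : nsq x = nsq a := by simp [x, nsq, Fin.sum_univ_add]
  have hxx : (hm q p x x).re = nsq a := by
    rw [hm_re_append]; simp [nsq]
  have ha0 := nsq_pos ha
  have hyK : nsq y ≤ K * nsq a := hY a
  have b1 : |(hm q p x y).re| ≤ (1 + K) * nsq a := by
    refine (Complex.abs_re_le_norm _).trans ?_
    have := hm_cs x y
    rw [hx] at this
    refine abs_le_of_sq_le_sq' ?_ (by positivity) |>.2
    nlinarith [mul_le_mul_of_nonneg_left hyK ha0.le, sq_nonneg (K * nsq a),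
      mul_nonneg hK (sq_nonneg (nsq a)), sq_nonneg (nsq a)]
  have b2 : |(hm q p y y).re| ≤ K * nsq a := by
    refine (Complex.abs_re_le_norm _).trans ?_
    have := hm_cs y y
    refine le_trans ?_ hyK
    refine abs_le_of_sq_le_sq' ?_ (nsq_nonneg _) |>.2
    nlinarith
  have e2 : (hm q p (x + (t : ℂ) • y) (x + (t : ℂ) • y)).re =
      nsq a + 2 * t * (hm q p x y).re + t * t * (hm q p y y).re := by
    have h1 : hm q p (x + (t : ℂ) • y) (x + (t : ℂ) • y) = hm q p x x + (t : ℂ) *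
      (hm q p x y + star (hm q p x y)) + (t : ℂ) * ((t : ℂ) * hm q p y y) := by
      rw [hm_star]
      simp only [hm_add_left, hm_add_right, hm_smul_left, hm_smul_right, Complex.star_def,
          Complex.conj_ofReal]
      ring
    rw [h1, Complex.add_re, Complex.add_re, Complex.re_ofReal_mul, Complex.re_ofReal_mul,
      Complex.re_ofReal_mul, hxx, Complex.add_re]
    simp
    ring
  rw [e2]
  have c1 := (abs_le.mp b1).1
  have c2 := (abs_le.mp b2).1
  have ht4 : t * (4 * (1 + K)) < 1 := by rwa [lt_div_iff₀ (by positivity)] at htd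
  have t1 : t < 1 := by nlinarith
  have c3 := mul_le_mul_of_nonneg_left c1 ht.le
  have c4 := mul_le_mul_of_nonneg_left c2 (mul_pos ht ht).le
  have c5 : t * ((1 + K) * nsq a) ≤ nsq a / 4 := by nlinarith
  have c6 : t * t * (K * nsq a) ≤ nsq a / 4 := by
    have : t * t * (K * nsq a) ≤ t * (K * nsq a) := by
      have : 0 ≤ t * (K * nsq a) := by positivity
      nlinarith
    nlinarith
  nlinarith

theorem span_pos {q p : ℕ} {X : Fin q → Fin (q + p) → ℂ}
    (h : ∀ a : Fin q → ℂ, a ≠ 0 → 0 < (hm q p (∑ i, a i • X i) (∑ i, a i • X i)).re) :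
    Pos (Submodule.span ℂ (Set.range X)) ∧
      Module.finrank ℂ (Submodule.span ℂ (Set.range X)) = q := by
  constructor
  · intro x hx hne
    obtain ⟨a, rfl⟩ := (Submodule.mem_span_range_iff_exists_fun ℂ).mp hx
    refine h a ?_
    rintro rfl
    simp at hne
  · have : LinearIndependent ℂ X := by
      rw [Fintype.linearIndependent_iff]
      intro a ha
      by_contra hne
      have : a ≠ 0 := by rintro rfl; simp at hne
      have := h a this
      rw [ha] at this
      simp at this
    rw [finrank_span_eq_card this]; simp

theorem dependK {q p m n : ℕ} {P : Fin (m + n) → MvPolynomial (Fin (q + p)) ℂ}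
    (hD : ∀ E : Submodule ℂ (Fin (q + p) → ℂ), Pos E → Module.finrank ℂ E = q →
      ∃ U : Submodule ℂ (Fin (m + n) → ℂ), Pos U ∧ Module.finrank ℂ U ≤ m ∧
      ∀ x ∈ E, ev P x ∈ U)
    {ι : Type*} [Fintype ι] [DecidableEq ι] (hι : m < Fintype.card ι) (C : ι → Fin q → ℂ)
    (X : Fin q → Fin (q + p) → ℂ) :
    ¬ LinearIndependent ℂ (fun j => ev P (∑ i, C j i • X i)) := by
  intro hli
  obtain ⟨Φ, hΦ⟩ := det_indep hli
  obtain ⟨δ, hδ, hpos⟩ := small_pos (fun i => X i - stdv q p i)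
  have key : PolyFn (fun t => (Matrix.of fun a b => Φ b (ev P
      (∑ i, C a i • (stdv q p i + t • (X i - stdv q p i)))) : Matrix ι ι ℂ).det) := by
    refine PolyFn.det fun a b => ?_
    simp only [Matrix.of_apply]
    refine PolyFn.linear (fun k => ?_) _
    refine PolyFn.eval _ fun j => ?_
    simp only [Finset.sum_apply, Pi.smul_apply, Pi.add_apply, smul_eq_mul]
    exact PolyFn.sum _ fun i _ => (PolyFn.const _).mul
      ((PolyFn.const _).add (PolyFn.id.mul (PolyFn.const _)))
  refine hΦ ?_
  have h1 := key.eq_zero (((Set.Ioo_infinite hδ).image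
    (Complex.ofReal_injective.injOn)).mono ?_) 1
  · simpa using h1
  · rintro _ ⟨t, ht, rfl⟩
    simp only [Set.mem_ofPred_eq]
    obtain ⟨s1, s2⟩ := span_pos (hpos t ht.1 ht.2)
    obtain ⟨U, _, hU2, hU3⟩ := hD _ s1 s2
    refine det_dep (pos_dep hU2 hι fun j => hU3 _ ?_) Φ
    exact Submodule.sum_mem _ fun i _ => Submodule.smul_mem _ _ (Submodule.subset_span ⟨i, rfl⟩)

/-- sign matrix -/
def JJ (m n : ℕ) : Matrix (Fin (m + n)) (Fin (m + n)) ℂ := Matrix.diagonal (eps m n)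

theorem JJ_sq (m n : ℕ) : JJ m n * JJ m n = 1 := by
  simp [JJ, eps_mul_self]
theorem JJ_herm (m n : ℕ) : (JJ m n)ᴴ = JJ m n := by
  simp only [JJ, diagonal_conjTranspose]
  congr 1
  ext i
  exact star_eps _ _ _

theorem hm_eq_mul {m n : ℕ} {ι : Type*} (Q : Matrix ι (Fin (m + n)) ℂ) (i j : ι) :
    (Q * JJ m n * Qᴴ) i j = hm m n (Q i) (Q j) := by
  rw [Matrix.mul_apply]
  simp only [JJ, hm, mul_diagonal, conjTranspose_apply]
  exact Finset.sum_congr rfl fun k _ => by ring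

theorem cayley {N : ℕ} {J X : Matrix (Fin N) (Fin N) ℂ} (hX : X * J + J * Xᴴ = 0)
    (hdet : (1 + X).det ≠ 0) :
    ((1 - X) * (1 + X)⁻¹) * J * ((1 - X) * (1 + X)⁻¹)ᴴ = J := by
  have hu : IsUnit (1 + X).det := isUnit_iff_ne_zero.mpr hdet
  have hu' : IsUnit (1 + X)ᴴ.det := by
    rw [det_conjTranspose]; exact hu.star
  have hc : (1 - X) * (1 + X)⁻¹ = (1 + X)⁻¹ * (1 - X) := by
    have h1 : (1 + X) * (1 - X) = (1 - X) * (1 + X) := by noncomm_ring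
    calc (1 - X) * (1 + X)⁻¹ = (1 + X)⁻¹ * ((1 + X) * (1 - X)) * (1 + X)⁻¹ := by
          rw [nonsing_inv_mul_cancel_left _ _ hu]
      _ = (1 + X)⁻¹ * (1 - X) := by
          rw [h1, ← Matrix.mul_assoc, mul_nonsing_inv_cancel_right _ _ hu]
  have h2 : (1 - X) * J * (1 - X)ᴴ = (1 + X) * J * (1 + X)ᴴ := by
    simp only [conjTranspose_sub, conjTranspose_add, conjTranspose_one]
    have : (1 - X) * J * (1 - Xᴴ) = (1 + X) * J * (1 + Xᴴ) - (2:ℂ) • (X * J + J * Xᴴ) := by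
      rw [two_smul]
      noncomm_ring
    rw [this, hX]; simp
  rw [hc, conjTranspose_mul]
  calc (1 + X)⁻¹ * (1 - X) * J * ((1 - X)ᴴ * (1 + X)⁻¹ᴴ)
      = (1 + X)⁻¹ * ((1 - X) * J * (1 - X)ᴴ) * (1 + X)⁻¹ᴴ := by simp only [Matrix.mul_assoc]
    _ = ((1 + X)⁻¹ * (1 + X)) * J * ((1 + X)ᴴ * (1 + X)⁻¹ᴴ) := by
        rw [h2]; simp only [Matrix.mul_assoc]
    _ = J := by
        rw [nonsing_inv_mul _ hu, conjTranspose_nonsing_inv, mul_nonsing_inv _ hu']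
        simp

theorem PolyFn.adj {N : ℕ} {M : ℂ → Matrix (Fin N) (Fin N) ℂ}
    (hM : ∀ i j, PolyFn (fun t => M t i j)) (i j : Fin N) :
    PolyFn (fun t => (M t).adjugate i j) := by
  simp only [adjugate_apply]
  refine PolyFn.det fun a b => ?_
  by_cases h : a = j
  · subst h; simpa using PolyFn.const _
  · simpa [updateRow_ne h] using hM a b

theorem generic {m n : ℕ} {Ψ : Matrix (Fin (m + n)) (Fin (m + n)) ℂ → ℂ} (hΨ : PF Ψ)
    (hsc : ∀ (c : ℂ) M, c ≠ 0 → Ψ M ≠ 0 → Ψ (c • M) ≠ 0) (hex : ∃ M, Ψ M ≠ 0) :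
    ∃ Q : Matrix (Fin (m + n)) (Fin (m + n)) ℂ, Ψ Q ≠ 0 ∧ Q * JJ m n * Qᴴ = JJ m n := by
  obtain ⟨M0, hM0⟩ := hex
  obtain ⟨t, ht⟩ : ∃ t : ℂ, t ≠ 0 ∧ (1 + t • M0).det ≠ 0 := by
    have h1 : PolyFn (fun t : ℂ => (1 + t • M0).det) := PolyFn.det fun i j => by
      simp only [Matrix.add_apply, Matrix.smul_apply, smul_eq_mul]
      exact (PolyFn.const _).add (PolyFn.id.mul (PolyFn.const _))
    have h2 := h1.finite_zeros (t₀ := 0) (by simp)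
    obtain ⟨t, ht⟩ := (h2.union (Set.finite_singleton (0:ℂ))).exists_notMem
    simp only [Set.mem_union, Set.mem_ofPred_eq, Set.mem_singleton_iff, not_or] at ht
    exact ⟨t, ht.2, ht.1⟩
  set M := t • M0
  have hM : Ψ M ≠ 0 := hsc _ _ ht.1 hM0
  have hu : IsUnit (1 + M).det := isUnit_iff_ne_zero.mpr ht.2
  set X := (1 - M) * (1 + M)⁻¹ with hX
  have e1 : 1 + X = (2:ℂ) • (1 + M)⁻¹ := by
    have : (1 : Matrix (Fin (m + n)) (Fin (m + n)) ℂ) = (1 + M) * (1 + M)⁻¹ :=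
      (mul_nonsing_inv _ hu).symm
    rw [hX]; nth_rewrite 1 [this]
    rw [← Matrix.add_mul, two_smul]; noncomm_ring
  have e2 : 1 - X = (2:ℂ) • (M * (1 + M)⁻¹) := by
    have : (1 : Matrix (Fin (m + n)) (Fin (m + n)) ℂ) = (1 + M) * (1 + M)⁻¹ :=
      (mul_nonsing_inv _ hu).symm
    rw [hX]; nth_rewrite 1 [this]
    rw [← Matrix.sub_mul, two_smul]; noncomm_ring
  have e3 : 1 - X = M * (1 + X) := by rw [e1, e2]; simp
  have hdX : (1 + X).det ≠ 0 := by
    rw [e1, det_smul]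
    refine mul_ne_zero (by simp) ?_
    exact (isUnit_nonsing_inv_det _ hu).ne_zero
  set J := JJ m n
  have hJ2 : J * J = 1 := JJ_sq m n
  have hJh : Jᴴ = J := JJ_herm m n
  set X1 := (2⁻¹ : ℂ) • (X - J * Xᴴ * J) with hX1
  set X2 := (-Complex.I * 2⁻¹ : ℂ) • (X + J * Xᴴ * J) with hX2
  have hsk1 : X1 * J + J * X1ᴴ = 0 := by
    rw [hX1]
    simp only [conjTranspose_smul, conjTranspose_sub, conjTranspose_mul, conjTranspose_conjTranspose,
      hJh, Matrix.smul_mul, Matrix.mul_smul, Matrix.sub_mul, Matrix.mul_sub, Matrix.mul_assoc, hJ2,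
      Matrix.mul_one]
    simp only [← Matrix.mul_assoc, hJ2, Matrix.one_mul]
    simp
    rw [← smul_add]; simp
  have hsk2 : X2 * J + J * X2ᴴ = 0 := by
    rw [hX2]
    simp only [conjTranspose_smul, conjTranspose_add, conjTranspose_mul, conjTranspose_conjTranspose,
      hJh, Matrix.smul_mul, Matrix.mul_smul, Matrix.add_mul, Matrix.mul_add, Matrix.mul_assoc, hJ2,
      Matrix.mul_one]
    simp only [← Matrix.mul_assoc, hJ2, Matrix.one_mul]
    simp
  have hsum : X1 + Complex.I • X2 = X := by
    rw [hX1, hX2, smul_smul]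
    have : Complex.I * (-Complex.I * 2⁻¹) = 2⁻¹ := by
      linear_combination (-2⁻¹ : ℂ) * Complex.I_mul_I
    rw [this, ← smul_add, sub_add_add_cancel, ← two_smul ℂ, smul_smul]
    simp
  have hXs : ∀ i j, PolyFn (fun s : ℂ => (X1 + s • X2) i j) := fun i j => by
    simp only [Matrix.add_apply, Matrix.smul_apply, smul_eq_mul]
    exact (PolyFn.const _).add (PolyFn.id.mul (PolyFn.const _))
  have hp : ∀ i j, PolyFn (fun s : ℂ => (1 + (X1 + s • X2)) i j) := fun i j => by
    simp only [Matrix.add_apply _ (X1 + _)]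
    exact (PolyFn.const _).add (hXs i j)
  have hq : ∀ i j, PolyFn (fun s : ℂ => (1 - (X1 + s • X2)) i j) := fun i j => by
    simp only [Matrix.sub_apply]
    exact (PolyFn.const _).sub (hXs i j)
  have key : PolyFn (fun s : ℂ => Ψ ((1 - (X1 + s • X2)) * (1 + (X1 + s • X2)).adjugate) *
      (1 + (X1 + s • X2)).det) := by
    refine (hΨ _ fun i j => ?_).mul (PolyFn.det hp)
    simp only [Matrix.mul_apply]
    exact PolyFn.sum _ fun k _ => (hq _ _).mul (PolyFn.adj hp _ _)
  have hfin := key.finite_zeros (t₀ := Complex.I) (by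
    rw [hsum]
    refine mul_ne_zero ?_ hdX
    rw [e3, Matrix.mul_assoc, mul_adjugate]
    rw [Matrix.mul_smul, Matrix.mul_one]
    exact hsc _ _ hdX hM)
  obtain ⟨s, hs⟩ : ∃ s : ℝ, Ψ ((1 - (X1 + (s:ℂ) • X2)) * (1 + (X1 + (s:ℂ) • X2)).adjugate) *
      (1 + (X1 + (s:ℂ) • X2)).det ≠ 0 := by
    by_contra hcon
    push Not at hcon
    refine (real_infinite 0) (hfin.subset ?_)
    rintro _ ⟨s, -, rfl⟩
    exact hcon s
  set Y := X1 + (s:ℂ) • X2 with hY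
  have hYsk : Y * J + J * Yᴴ = 0 := by
    have : Y * J + J * Yᴴ = (X1 * J + J * X1ᴴ) + (s:ℂ) • (X2 * J + J * X2ᴴ) := by
      rw [hY]
      simp only [conjTranspose_add, conjTranspose_smul, Complex.star_def, Complex.conj_ofReal,
        Matrix.add_mul, Matrix.mul_add, Matrix.smul_mul, Matrix.mul_smul, smul_add]
      abel
    rw [this, hsk1, hsk2]; simp
  have hd := right_ne_zero_of_mul hs
  refine ⟨(1 - Y) * (1 + Y)⁻¹, ?_, cayley hYsk hd⟩
  have := hsc ((1 + Y).det)⁻¹ _ (inv_ne_zero hd) (left_ne_zero_of_mul hs)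
  rwa [← Matrix.mul_smul, ← Ring.inverse_eq_inv', ← inv_def] at this

/-- `P u, P v, P (u+v)` -/
noncomputable def tri {N : ℕ} {τ : Type*} (P : τ → MvPolynomial (Fin N) ℂ) (u v : Fin N → ℂ) :
    Fin 3 → τ → ℂ := fun a => ev P ((![u, v, u + v] : Fin 3 → Fin N → ℂ) a)

/-- the test determinant -/
noncomputable def mdet {N N' : ℕ} (P : Fin N' → MvPolynomial (Fin N) ℂ)
    (Φ : Fin 3 → (Fin N' → ℂ) →ₗ[ℂ] ℂ) (u v : Fin N → ℂ) : ℂ :=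
  (Matrix.of fun a b => Φ b (tri P u v a)).det

theorem mdet_smul {N N' d : ℕ} {P : Fin N' → MvPolynomial (Fin N) ℂ}
    (hh : ∀ t, (P t).IsHomogeneous d)
    (Φ : Fin 3 → (Fin N' → ℂ) →ₗ[ℂ] ℂ) (u v : Fin N → ℂ) (c : ℂ) :
    mdet P Φ (c • u) (c • v) = (c ^ d) ^ 3 * mdet P Φ u v := by
  have h1 : ∀ a, tri P (c • u) (c • v) a = c ^ d • tri P u v a := by
    intro a
    unfold tri
    rw [← ev_smul hh]
    congr 1
    fin_cases a <;> simp
  have h2 : (Matrix.of fun a b => Φ b (tri P (c • u) (c • v) a) : Matrix (Fin 3) (Fin 3) ℂ) =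
      (c ^ d) • Matrix.of fun a b => Φ b (tri P u v a) := by
    ext a b
    simp [h1]
  rw [mdet, h2, det_smul]
  simp [mdet]

theorem mdet_PF {N N' : ℕ} (P : Fin N' → MvPolynomial (Fin N) ℂ)
    (Φ : Fin 3 → (Fin N' → ℂ) →ₗ[ℂ] ℂ) {α : Type*} (i j : α) :
    PF (fun M : Matrix α (Fin N) ℂ => mdet P Φ (M i) (M j)) := by
  intro M hM
  refine PolyFn.det fun a b => ?_
  simp only [Matrix.of_apply]
  refine PolyFn.linear (fun k => ?_) _
  refine PolyFn.eval _ fun l => ?_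
  fin_cases a
  · simpa using hM i l
  · simpa using hM j l
  · simpa using (hM i l).add (hM j l)

theorem mdet_ex {N N' : ℕ} {P : Fin N' → MvPolynomial (Fin N) ℂ}
    {Φ : Fin 3 → (Fin N' → ℂ) →ₗ[ℂ] ℂ} {u v : Fin N → ℂ} (h : mdet P Φ u v ≠ 0)
    {α : Type*} [DecidableEq α] {i j : α} (hij : i ≠ j) :
    ∃ M : Matrix α (Fin N) ℂ, mdet P Φ (M i) (M j) ≠ 0 :=
  ⟨fun a => if a = i then u else v, by simpa [hij.symm] using h⟩

theorem mdet_indep {N N' : ℕ} {P : Fin N' → MvPolynomial (Fin N) ℂ}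
    {Φ : Fin 3 → (Fin N' → ℂ) →ₗ[ℂ] ℂ} {u v : Fin N → ℂ} (h : mdet P Φ u v ≠ 0) :
    LinearIndependent ℂ (tri P u v) := by
  by_contra hc
  exact h (det_dep hc Φ)

theorem span_orth {m n : ℕ} {ι κ : Type*} {v : ι → Fin (m + n) → ℂ} {w : κ → Fin (m + n) → ℂ}
    (h : ∀ i j, hm m n (v i) (w j) = 0) {s s' : Fin (m + n) → ℂ}
    (hs : s ∈ Submodule.span ℂ (Set.range v)) (hs' : s' ∈ Submodule.span ℂ (Set.range w)) :
    hm m n s s' = 0 := by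
  induction hs using Submodule.span_induction with
  | mem x hx =>
    obtain ⟨i, rfl⟩ := hx
    induction hs' using Submodule.span_induction with
    | mem y hy => obtain ⟨j, rfl⟩ := hy; exact h i j
    | zero => simp
    | add x y _ _ h1 h2 => rw [hm_add_right, h1, h2, add_zero]
    | smul c x _ h1 => rw [hm_smul_right, h1, mul_zero]
  | zero => simp
  | add x y _ _ h1 h2 => rw [hm_add_left, h1, h2, add_zero]
  | smul c x _ h1 => rw [hm_smul_left, h1, mul_zero]

theorem dependK' {q p m n : ℕ} {P : Fin (m + n) → MvPolynomial (Fin (q + p)) ℂ}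
    (hD : ∀ E : Submodule ℂ (Fin (q + p) → ℂ), Pos E → Module.finrank ℂ E = q →
      ∃ U : Submodule ℂ (Fin (m + n) → ℂ), Pos U ∧ Module.finrank ℂ U ≤ m ∧
      ∀ x ∈ E, ev P x ∈ U)
    {ι : Type*} [Fintype ι] [DecidableEq ι] (hι : m < Fintype.card ι)
    (X : Fin q → Fin (q + p) → ℂ) (y : ι → Fin (q + p) → ℂ)
    (hy : ∀ j, y j ∈ Submodule.span ℂ (Set.range X)) :
    ¬ LinearIndependent ℂ (fun j => ev P (y j)) := by
  have : ∀ j, ∃ C : Fin q → ℂ, ∑ i, C i • X i = y j := fun j =>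
    (Submodule.mem_span_range_iff_exists_fun ℂ).mp (hy j)
  choose C hC using this
  have := dependK hD hι C X
  simpa only [hC] using this

section T
variable {k p n d : ℕ} {P : Fin (k + 3 + 1 + n) → MvPolynomial (Fin (k + 3 + p)) ℂ}

theorem Kred
    (hD : ∀ E : Submodule ℂ (Fin (k + 3 + p) → ℂ), Pos E → Module.finrank ℂ E = k + 3 →
      ∃ U : Submodule ℂ (Fin (k + 3 + 1 + n) → ℂ), Pos U ∧ Module.finrank ℂ U ≤ k + 3 + 1 ∧
      ∀ x ∈ E, ev P x ∈ U)
    (hO : ∀ z w, 0 < (hm (k + 3) p z z).re → hm (k + 3) p z w = 0 →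
      hm (k + 3 + 1) n (ev P w) (ev P z) = 0)
    (hpos : ∀ z, 0 < (hm (k + 3) p z z).re → ev P z ≠ 0 →
      0 < (hm (k + 3 + 1) n (ev P z) (ev P z)).re)
    (u v c : Fin (k + 3 + p) → ℂ) (a : Fin k → Fin (k + 3 + p) → ℂ)
    (ha : ∀ i, 0 < (hm (k + 3) p (a i) (a i)).re) (haP : ∀ i, ev P (a i) ≠ 0)
    (haa : ∀ i j, i ≠ j → hm (k + 3) p (a i) (a j) = 0)
    (hau : ∀ i, hm (k + 3) p (a i) u = 0) (hav : ∀ i, hm (k + 3) p (a i) v = 0)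
    (hac : ∀ i, hm (k + 3) p (a i) c = 0) :
    ∃ g : Fin 5 → ℂ, g ≠ 0 ∧ g 0 • ev P u + g 1 • ev P v + g 2 • ev P (u + v) + g 3 • ev P c +
      g 4 • ev P (u + c) = 0 := by
  set y : Fin 5 ⊕ Fin k → Fin (k + 3 + p) → ℂ :=
    Sum.elim ![u, v, u + v, c, u + c] a with hy
  set X : Fin (k + 3) → Fin (k + 3 + p) → ℂ := Fin.cons u (Fin.cons v (Fin.cons c a)) with hX
  have mu : u ∈ Submodule.span ℂ (Set.range X) := Submodule.subset_span ⟨0, rfl⟩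
  have mv : v ∈ Submodule.span ℂ (Set.range X) := Submodule.subset_span ⟨Fin.succ 0, rfl⟩
  have mc : c ∈ Submodule.span ℂ (Set.range X) :=
    Submodule.subset_span ⟨Fin.succ (Fin.succ 0), rfl⟩
  have ma : ∀ i, a i ∈ Submodule.span ℂ (Set.range X) := fun i =>
    Submodule.subset_span ⟨Fin.succ (Fin.succ (Fin.succ i)), rfl⟩
  have hdep := dependK' hD (ι := Fin 5 ⊕ Fin k) (by simp; omega) X y (by
    rintro (j | j)
    · fin_cases j
      · exact mu
      · exact mv
      · exact Submodule.add_mem _ mu mv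
      · exact mc
      · exact Submodule.add_mem _ mu mc
    · exact ma j)
  rw [Fintype.not_linearIndependent_iff] at hdep
  obtain ⟨g, hg, i0, hi0⟩ := hdep
  have hg' := hg
  rw [Fintype.sum_sum_type] at hg
  have hb : ∀ i, g (Sum.inr i) = 0 := by
    intro i
    have h1 := congrArg (fun x => hm (k + 3 + 1) n x (ev P (a i))) hg'
    simp only [hm_sum_left, hm_smul_left, hm_zero_left] at h1
    rw [Finset.sum_eq_single (Sum.inr i)] at h1
    · have h2 := hpos _ (ha i) (haP i)
      refine (mul_eq_zero.mp h1).resolve_right fun h => ?_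
      simp only [hy, Sum.elim_inr] at h
      rw [h] at h2; simp at h2
    · rintro (j | j) _ hne
      · rw [hO (a i) _ (ha i), mul_zero]
        fin_cases j
        · exact hau i
        · exact hav i
        · exact (hm_add_right _ _ _).trans (by rw [hau, hav, add_zero])
        · exact hac i
        · exact (hm_add_right _ _ _).trans (by rw [hau, hac, add_zero])
      · rw [hO (a i) _ (ha i), mul_zero]
        refine haa i j ?_
        rintro rfl; exact hne rfl
    · simp
  refine ⟨fun j => g (Sum.inl j), ?_, ?_⟩
  · intro h
    rcases i0 with j | j
    · exact hi0 (congrFun h j)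
    · exact hi0 (hb j)
  · simp only [hb, zero_smul, Finset.sum_const_zero, add_zero, Fin.sum_univ_five] at hg
    exact hg

theorem frame_indep_pos {q p : ℕ} {Q : Matrix (Fin (q + p)) (Fin (q + p)) ℂ}
    (hQ : Q * JJ q p * Qᴴ = JJ q p) (a : Fin q → ℂ) (ha : a ≠ 0) :
    0 < (hm q p (∑ i, a i • Q (Fin.castAdd p i)) (∑ i, a i • Q (Fin.castAdd p i))).re := by
  have h1 : hm q p (∑ i, a i • Q (Fin.castAdd p i)) (∑ i, a i • Q (Fin.castAdd p i)) =
      ((nsq a : ℝ) : ℂ) := by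
    rw [hm_sum_left, ← nsq_eq, dotProduct]
    refine Finset.sum_congr rfl fun i _ => ?_
    rw [hm_smul_left, ← hm_star, hm_sum_left]
    rw [Finset.sum_eq_single i]
    · rw [hm_smul_left, ← hm_eq_mul, hQ]
      simp [JJ, eps, mul_comm]
    · intro j _ hj
      rw [hm_smul_left, ← hm_eq_mul, hQ]
      simp [JJ, hj]
    · simp
  rw [h1]; exact nsq_pos ha

theorem claimT (hp : 2 ≤ p) (hh : ∀ t, (P t).IsHomogeneous d) (hP0 : ∃ t, P t ≠ 0)
    (hD : ∀ E : Submodule ℂ (Fin (k + 3 + p) → ℂ), Pos E → Module.finrank ℂ E = k + 3 →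
      ∃ U : Submodule ℂ (Fin (k + 3 + 1 + n) → ℂ), Pos U ∧ Module.finrank ℂ U ≤ k + 3 + 1 ∧
      ∀ x ∈ E, ev P x ∈ U)
    (hO : ∀ z w, 0 < (hm (k + 3) p z z).re → hm (k + 3) p z w = 0 →
      hm (k + 3 + 1) n (ev P w) (ev P z) = 0)
    (hpos : ∀ z, 0 < (hm (k + 3) p z z).re → ev P z ≠ 0 →
      0 < (hm (k + 3 + 1) n (ev P z) (ev P z)).re)
    (u v : Fin (k + 3 + p) → ℂ) : ¬ LinearIndependent ℂ (tri P u v) := by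
  intro hLI
  obtain ⟨Φ, hΦ⟩ := det_indep hLI
  change mdet P Φ u v ≠ 0 at hΦ
  obtain ⟨t0, ht0⟩ := hP0
  obtain ⟨x0, hx0⟩ : ∃ x, eval x (P t0) ≠ 0 := by
    by_contra hc
    push Not at hc
    exact ht0 (MvPolynomial.funext fun x => by simp [hc x])
  let i0 : Fin (k + 3 + p) := ⟨0, by omega⟩
  let i1 : Fin (k + 3 + p) := ⟨1, by omega⟩
  let j0 : Fin (k + 3 + p) := ⟨k + 3, by omega⟩
  let j1 : Fin (k + 3 + p) := ⟨k + 3 + 1, by omega⟩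
  let ia : Fin k → Fin (k + 3 + p) := fun i => ⟨i + 3, by omega⟩
  obtain ⟨Q, hΨ, hQ⟩ := generic (m := k + 3) (n := p)
    (Ψ := fun M => mdet P Φ (M i0) (M i1) * (mdet P Φ (M j0) (M j1) * (mdet P Φ (M i0) (M j0) *
      ∏ i : Fin k, eval (M (ia i)) (P t0))))
    ((mdet_PF P Φ i0 i1).mul ((mdet_PF P Φ j0 j1).mul ((mdet_PF P Φ i0 j0).mul
      (PF.prod _ fun i _ M hM => PolyFn.eval _ fun j => hM _ _))))
    (by
      intro c M hc hM
      have e : ∀ i, (c • M) i = c • M i := fun i => rfl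
      simp only [e, mdet_smul hh, eval_smul_hom (hh t0), Finset.prod_mul_distrib] at hM ⊢
      simp only [mul_ne_zero_iff] at hM ⊢
      have hcd : c ^ d ≠ 0 := pow_ne_zero _ hc
      refine ⟨⟨pow_ne_zero _ hcd, hM.1⟩, ⟨pow_ne_zero _ hcd, hM.2.1⟩,
        ⟨pow_ne_zero _ hcd, hM.2.2.1⟩, ?_, hM.2.2.2⟩
      simp [hc])
    (by
      refine PF.mul_ne (mdet_PF P Φ i0 i1) ((mdet_PF P Φ j0 j1).mul ((mdet_PF P Φ i0 j0).mul
        (PF.prod _ fun i _ M hM => PolyFn.eval _ fun j => hM _ _)))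
        (mdet_ex hΦ (by simp [i0, i1])) ?_
      refine PF.mul_ne (mdet_PF P Φ j0 j1) ((mdet_PF P Φ i0 j0).mul
        (PF.prod _ fun i _ M hM => PolyFn.eval _ fun j => hM _ _))
        (mdet_ex hΦ (by simp [j0, j1])) ?_
      refine PF.mul_ne (mdet_PF P Φ i0 j0)
        (PF.prod _ fun i _ M hM => PolyFn.eval _ fun j => hM _ _)
        (mdet_ex hΦ (by simp [i0, j0])) ?_
      exact PF.prod_ne _ (fun i _ M hM => PolyFn.eval _ fun j => hM _ _)
        (fun i _ => ⟨fun _ => x0, hx0⟩))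
  simp only [mul_ne_zero_iff, Finset.prod_ne_zero_iff] at hΨ
  obtain ⟨m1, m2, m3, m4⟩ := hΨ
  have hF : ∀ i j, hm (k + 3) p (Q i) (Q j) = if i = j then eps (k + 3) p i else 0 := by
    intro i j
    rw [← hm_eq_mul, hQ, JJ, diagonal_apply]
  set e := Q i0
  set f := Q i1
  set c := Q j0
  set g := Q j1
  have haP : ∀ i, ev P (Q (ia i)) ≠ 0 := fun i h => m4 i (Finset.mem_univ _) (congrFun h t0)
  have hee : hm (k + 3) p e e = 1 := by rw [hF]; simp [i0, eps]
  have hff : hm (k + 3) p f f = 1 := by rw [hF]; simp [i1, eps]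
  have hef : hm (k + 3) p e f = 0 := by rw [hF]; simp [i0, i1]
  have hfe : hm (k + 3) p f e = 0 := by rw [hF]; simp [i0, i1]
  have hec : hm (k + 3) p e c = 0 := by rw [hF]; simp [i0, j0]
  have heg : hm (k + 3) p e g = 0 := by rw [hF]; simp [i0, j1]
  have hfc : hm (k + 3) p f c = 0 := by rw [hF, if_neg]; simp only [i1, j0, Fin.mk.injEq]; omega
  have hfg : hm (k + 3) p f g = 0 := by rw [hF, if_neg]; simp only [i1, j1, Fin.mk.injEq]; omega
  have ha : ∀ i, 0 < (hm (k + 3) p (Q (ia i)) (Q (ia i))).re := by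
    intro i; rw [hF]; simp [ia, eps]
  have haa : ∀ i j, i ≠ j → hm (k + 3) p (Q (ia i)) (Q (ia j)) = 0 := by
    intro i j hij
    rw [hF, if_neg]; simp only [ia, Fin.mk.injEq]
    intro h; exact hij (Fin.ext (by omega))
  have hae : ∀ i, hm (k + 3) p (Q (ia i)) e = 0 := by
    intro i; rw [hF, if_neg]; simp only [ia, i0, Fin.mk.injEq]; omega
  have haf : ∀ i, hm (k + 3) p (Q (ia i)) f = 0 := by
    intro i; rw [hF, if_neg]; simp only [ia, i1, Fin.mk.injEq]; omega
  have hac : ∀ i, hm (k + 3) p (Q (ia i)) c = 0 := by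
    intro i; rw [hF, if_neg]; simp only [ia, j0, Fin.mk.injEq]; omega
  have hag : ∀ i, hm (k + 3) p (Q (ia i)) g = 0 := by
    intro i; rw [hF, if_neg]; simp only [ia, j1, Fin.mk.injEq]; omega
  have L1 := mdet_indep m1
  have L2 := mdet_indep m2
  have L3 := mdet_indep m3
  set S := Submodule.span ℂ (Set.range (tri P e f)) with hS
  set S' := Submodule.span ℂ (Set.range (tri P c g)) with hS'
  have hSS : ∀ s ∈ S, ∀ s' ∈ S', hm (k + 3 + 1) n s' s = 0 := by
    intro s hs s' hs'
    refine span_orth (fun j i => ?_) hs' hs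
    unfold tri
    apply hO
    · fin_cases i
      · simp [hee]
      · simp [hff]
      · simp [hm_add_left, hm_add_right, hee, hff, hef, hfe]
    · fin_cases i <;> fin_cases j <;>
        simp [hm_add_left, hm_add_right, hec, heg, hfc, hfg]
  have hSpos : Pos S := by
    obtain ⟨s1, s2⟩ := span_pos (frame_indep_pos hQ)
    obtain ⟨U, hU, -, hU3⟩ := hD _ s1 s2
    have me : e ∈ Submodule.span ℂ (Set.range fun i => Q (Fin.castAdd p i)) :=
      Submodule.subset_span ⟨⟨0, by omega⟩, rfl⟩
    have mf : f ∈ Submodule.span ℂ (Set.range fun i => Q (Fin.castAdd p i)) :=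
      Submodule.subset_span ⟨⟨1, by omega⟩, rfl⟩
    have : S ≤ U := by
      rw [hS, Submodule.span_le]
      rintro _ ⟨i, rfl⟩
      refine hU3 _ ?_
      fin_cases i
      · exact me
      · exact mf
      · exact Submodule.add_mem _ me mf
    exact fun x hx => hU x (this hx)
  have se : ev P e ∈ S := Submodule.subset_span ⟨0, rfl⟩
  have sf : ev P f ∈ S := Submodule.subset_span ⟨1, rfl⟩
  have sef : ev P (e + f) ∈ S := Submodule.subset_span ⟨2, rfl⟩
  have sc : ev P c ∈ S' := Submodule.subset_span ⟨0, rfl⟩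
  have sg : ev P g ∈ S' := Submodule.subset_span ⟨1, rfl⟩
  have scg : ev P (c + g) ∈ S' := Submodule.subset_span ⟨2, rfl⟩
  have hPe : ev P e ≠ 0 := L1.ne_zero 0
  have hPc : ev P c ≠ 0 := L2.ne_zero 0
  have inter : ∀ x ∈ S, x ∈ S' → x = 0 := by
    intro x hx hx'
    by_contra hne
    have := hSpos x hx hne
    rw [hSS x hx x hx'] at this
    simp at this
  obtain ⟨α, hα0, hα⟩ := Kred hD hO hpos e f c _ ha haP haa hae haf hac
  obtain ⟨β, hβ0, hβ⟩ := Kred hD hO hpos c g e _ ha haP haa hac hag hae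
  have lin1 : ∀ a b r : ℂ, a • ev P e + b • ev P f + r • ev P (e + f) = 0 →
      a = 0 ∧ b = 0 ∧ r = 0 := by
    intro a b r h
    have := Fintype.linearIndependent_iff.mp L1 ![a, b, r] (by
      simpa [Fin.sum_univ_three, tri] using h)
    exact ⟨this 0, this 1, this 2⟩
  have lin2 : ∀ a b r : ℂ, a • ev P c + b • ev P g + r • ev P (c + g) = 0 →
      a = 0 ∧ b = 0 ∧ r = 0 := by
    intro a b r h
    have := Fintype.linearIndependent_iff.mp L2 ![a, b, r] (by
      simpa [Fin.sum_univ_three, tri] using h)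
    exact ⟨this 0, this 1, this 2⟩
  have sα : α 0 • ev P e + α 1 • ev P f + α 2 • ev P (e + f) ∈ S :=
    S.add_mem (S.add_mem (S.smul_mem _ se) (S.smul_mem _ sf)) (S.smul_mem _ sef)
  have sβ : β 0 • ev P c + β 1 • ev P g + β 2 • ev P (c + g) ∈ S' :=
    S'.add_mem (S'.add_mem (S'.smul_mem _ sc) (S'.smul_mem _ sg)) (S'.smul_mem _ scg)
  have hα4 : α 4 ≠ 0 := by
    intro h
    rw [h, zero_smul, add_zero] at hα
    have e1 := eq_neg_of_add_eq_zero_left hα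
    have e2 := inter _ sα (by rw [e1]; exact S'.neg_mem (S'.smul_mem _ sc))
    obtain ⟨a0, a1, a2⟩ := lin1 _ _ _ e2
    rw [e2, zero_add] at hα
    have a3 := (smul_eq_zero.mp hα).resolve_right hPc
    apply hα0
    ext i; fin_cases i <;> assumption
  have hβ4 : β 4 ≠ 0 := by
    intro h
    rw [h, zero_smul, add_zero] at hβ
    have e1 := eq_neg_of_add_eq_zero_right hβ
    have e2 := inter _ (S.smul_mem (β 3) se) (by rw [e1]; exact S'.neg_mem sβ)
    have a3 := (smul_eq_zero.mp e2).resolve_right hPe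
    rw [e2, add_zero] at hβ
    obtain ⟨a0, a1, a2⟩ := lin2 _ _ _ hβ
    apply hβ0
    ext i; fin_cases i <;> assumption
  rw [add_comm c e] at hβ
  set sA := α 0 • ev P e + α 1 • ev P f + α 2 • ev P (e + f)
  set sB := β 0 • ev P c + β 1 • ev P g + β 2 • ev P (c + g)
  -- P(e+c) = -(sA + α3 Pc)/α4 = -(sB + β3 Pe)/β4
  have e3 : β 4 • sA - (α 4 * β 3) • ev P e = α 4 • sB - (β 4 * α 3) • ev P c := by
    have h1 := congrArg (fun x => β 4 • x) hα
    have h2 := congrArg (fun x => α 4 • x) hβ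
    simp only [smul_add, smul_smul, smul_zero] at h1 h2
    rw [mul_comm (β 4) (α 4)] at h1
    have h3 := h1.trans h2.symm
    have h4 := add_right_cancel h3
    rw [sub_eq_sub_iff_add_eq_add]
    exact h4
  have e4 := inter _ (S.sub_mem (S.smul_mem (β 4) sα) (S.smul_mem (α 4 * β 3) se)) (by
    rw [e3]; exact S'.sub_mem (S'.smul_mem _ sβ) (S'.smul_mem _ sc))
  have e5 : ![α 4 * β 3, β 4 * α 3, β 4 * α 4] = 0 := by
    ext i
    refine Fintype.linearIndependent_iff.mp L3 _ ?_ i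
    have h1 := congrArg (fun x => β 4 • x) hα
    simp only [smul_add, smul_smul, smul_zero] at h1
    rw [sub_eq_zero.mp e4] at h1
    simpa [Fin.sum_univ_three, tri] using h1
  have := congrFun e5 2
  simp [hα4, hβ4] at this
end T

/-- linear form -/
noncomputable def lf {N : ℕ} (c : Fin N → ℂ) : MvPolynomial (Fin N) ℂ := ∑ k, C (c k) * X k

theorem eval_lf {N : ℕ} (c v : Fin N → ℂ) : eval v (lf c) = ∑ k, c k * v k := by
  simp [lf]

theorem lf_hom {N : ℕ} (c : Fin N → ℂ) : (lf c).IsHomogeneous 1 :=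
  IsHomogeneous.sum _ _ _ fun k _ => by
    simpa using (isHomogeneous_C (Fin N) (c k)).mul (isHomogeneous_X ℂ k)

/-- gradient at `u` as a linear form -/
noncomputable def gr {N : ℕ} (F : MvPolynomial (Fin N) ℂ) (u : Fin N → ℂ) :
    MvPolynomial (Fin N) ℂ := lf fun k => eval u (pderiv k F)

theorem gr_add {N : ℕ} (F G : MvPolynomial (Fin N) ℂ) (u v : Fin N → ℂ) :
    eval v (gr (F + G) u) = eval v (gr F u) + eval v (gr G u) := by
  simp [gr, eval_lf, add_mul, Finset.sum_add_distrib]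

theorem gr_mul {N : ℕ} (F G : MvPolynomial (Fin N) ℂ) (u v : Fin N → ℂ) :
    eval v (gr (F * G) u) = eval u F * eval v (gr G u) + eval u G * eval v (gr F u) := by
  simp only [gr, eval_lf, Derivation.leibniz, smul_eq_mul, map_add, map_mul, add_mul,
    Finset.sum_add_distrib, Finset.mul_sum]
  congr 1 <;> exact Finset.sum_congr rfl fun i _ => by ring

theorem gr_C {N : ℕ} (c : ℂ) (u v : Fin N → ℂ) : eval v (gr (C c) u) = 0 := by
  simp [gr, eval_lf]

theorem gr_X {N : ℕ} (i : Fin N) (u v : Fin N → ℂ) : eval v (gr (X i) u) = v i := by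
  simp [gr, eval_lf, pderiv_X, Pi.single_apply, apply_ite]

theorem gr_sum {N : ℕ} {ι : Type*} (s : Finset ι) (F : ι → MvPolynomial (Fin N) ℂ)
    (u v : Fin N → ℂ) : eval v (gr (∑ i ∈ s, F i) u) = ∑ i ∈ s, eval v (gr (F i) u) := by
  classical
  induction s using Finset.induction_on with
  | empty => simpa using gr_C 0 u v
  | insert a s ha ih => rw [Finset.sum_insert ha, Finset.sum_insert ha, gr_add, ih]

theorem gr_lf {N : ℕ} (c u v : Fin N → ℂ) : eval v (gr (lf c) u) = eval v (lf c) := by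
  conv_lhs => rw [lf]
  rw [gr_sum, eval_lf]
  refine Finset.sum_congr rfl fun k _ => ?_
  rw [gr_mul, gr_C, gr_X]; simp

theorem gr_deriv {N : ℕ} (F : MvPolynomial (Fin N) ℂ) (u v : Fin N → ℂ) (s : ℂ) :
    HasDerivAt (fun s : ℂ => eval (u + s • v) F) (eval v (gr F (u + s • v))) s := by
  induction F using MvPolynomial.induction_on with
  | C a => simpa [gr_C] using hasDerivAt_const s a
  | add F G h1 h2 =>
    rw [gr_add]
    simp only [map_add]
    exact h1.add h2
  | mul_X F i h =>
    rw [gr_mul, gr_X]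
    simp only [map_mul, eval_X]
    have h2 : HasDerivAt (fun s : ℂ => (u + s • v) i) (v i) s := by
      simp only [Pi.add_apply, Pi.smul_apply, smul_eq_mul]
      simpa using ((hasDerivAt_id s).mul_const (v i)).const_add (u i)
    refine (h.mul h2).congr_deriv ?_
    ring

theorem dual_basis {ι : Type*} [Fintype ι] [DecidableEq ι] {N : ℕ} {v : ι → Fin N → ℂ}
    (h : LinearIndependent ℂ v) : ∃ Φ : ι → (Fin N → ℂ) →ₗ[ℂ] ℂ,
    ∀ a b, Φ b (v a) = if a = b then 1 else 0 := by
  have hinj : LinearMap.ker (Fintype.linearCombination ℂ v) = ⊥ := by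
    rw [LinearMap.ker_eq_bot]
    exact h.fintypeLinearCombination_injective
  obtain ⟨g, hg⟩ := LinearMap.exists_leftInverse_of_injective _ hinj
  refine ⟨fun b => (LinearMap.proj b).comp g, fun a b => ?_⟩
  have h1 := congrArg (fun l => l (Pi.single a 1)) hg
  simp only [LinearMap.comp_apply, Fintype.linearCombination_apply_single, one_smul,
    LinearMap.id_apply] at h1
  simp [h1, Pi.single_apply, eq_comm]

section L
variable {N N' d : ℕ} {P : Fin N' → MvPolynomial (Fin N) ℂ}

/-- combination of the components by a functional -/
noncomputable def pl (P : Fin N' → MvPolynomial (Fin N) ℂ) (φ : (Fin N' → ℂ) →ₗ[ℂ] ℂ) :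
    MvPolynomial (Fin N) ℂ := ∑ t, C (φ (Pi.single t 1)) * P t

theorem lin_expand (φ : (Fin N' → ℂ) →ₗ[ℂ] ℂ) (y : Fin N' → ℂ) :
    ∑ t, φ (Pi.single t 1) * y t = φ y := by
  conv_rhs => rw [← Finset.univ_sum_single y]
  rw [map_sum]
  refine Finset.sum_congr rfl fun i _ => ?_
  have : (Pi.single i (y i) : Fin N' → ℂ) = y i • Pi.single i 1 := by
    rw [← Pi.single_smul]; simp
  rw [this, map_smul, smul_eq_mul, mul_comm]

theorem eval_pl (φ : (Fin N' → ℂ) →ₗ[ℂ] ℂ) (z : Fin N → ℂ) : eval z (pl P φ) = φ (ev P z) := by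
  simp only [pl, map_sum, map_mul, eval_C]
  exact lin_expand φ (ev P z)

theorem pl_hom (hh : ∀ t, (P t).IsHomogeneous d) (φ : (Fin N' → ℂ) →ₗ[ℂ] ℂ) :
    (pl P φ).IsHomogeneous d :=
  IsHomogeneous.sum _ _ _ fun t _ => by
    simpa using (isHomogeneous_C (Fin N) (φ (Pi.single t 1))).mul (hh t)

/-- differential of the tuple -/
noncomputable def dP (P : Fin N' → MvPolynomial (Fin N) ℂ) (u v : Fin N → ℂ) : Fin N' → ℂ :=
  fun t => eval v (gr (P t) u)

theorem gr_pl (φ : (Fin N' → ℂ) →ₗ[ℂ] ℂ) (u v : Fin N → ℂ) :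
    eval v (gr (pl P φ) u) = φ (dP P u v) := by
  rw [pl, gr_sum, ← lin_expand φ]
  refine Finset.sum_congr rfl fun t _ => ?_
  rw [gr_mul, gr_C]; simp [dP]

/-- the determinant identity on P u, P v, DP(u)v -/
theorem det3_deriv (hh : ∀ t, (P t).IsHomogeneous d)
    (hT : ∀ u v, ¬ LinearIndependent ℂ (tri P u v)) (Φ : Fin 3 → (Fin N' → ℂ) →ₗ[ℂ] ℂ)
    (u v : Fin N → ℂ) :
    (Φ 1 (ev P u) * Φ 2 (ev P v) - Φ 2 (ev P u) * Φ 1 (ev P v)) * Φ 0 (dP P u v)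
    + (Φ 2 (ev P u) * Φ 0 (ev P v) - Φ 0 (ev P u) * Φ 2 (ev P v)) * Φ 1 (dP P u v)
    + (Φ 0 (ev P u) * Φ 1 (ev P v) - Φ 1 (ev P u) * Φ 0 (ev P v)) * Φ 2 (dP P u v) = 0 := by
  set c0 := Φ 1 (ev P u) * Φ 2 (ev P v) - Φ 2 (ev P u) * Φ 1 (ev P v)
  set c1 := Φ 2 (ev P u) * Φ 0 (ev P v) - Φ 0 (ev P u) * Φ 2 (ev P v)
  set c2 := Φ 0 (ev P u) * Φ 1 (ev P v) - Φ 1 (ev P u) * Φ 0 (ev P v)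
  set φ : (Fin N' → ℂ) →ₗ[ℂ] ℂ := c0 • Φ 0 + c1 • Φ 1 + c2 • Φ 2 with hφ
  have h1 : ∀ s : ℂ, s ≠ 0 → φ (ev P (u + s • v)) = 0 := by
    intro s hs
    have h := det_dep (hT u (s • v)) Φ
    rw [det_fin_three] at h
    simp only [Matrix.of_apply, tri, Matrix.cons_val_zero, Matrix.cons_val_one,
      Matrix.cons_val, ev_smul hh, map_smul, smul_eq_mul] at h
    have h2 : s ^ d * φ (ev P (u + s • v)) = 0 := by
      simp only [hφ, c0, c1, c2, LinearMap.add_apply, LinearMap.smul_apply, smul_eq_mul]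
      linear_combination h
    exact (mul_eq_zero.mp h2).resolve_left (pow_ne_zero _ hs)
  have hpf : PolyFn (fun s : ℂ => φ (ev P (u + s • v))) := by
    refine PolyFn.linear (fun t => PolyFn.eval _ fun i => ?_) φ
    simp only [Pi.add_apply, Pi.smul_apply, smul_eq_mul]
    exact (PolyFn.const _).add (PolyFn.id.mul (PolyFn.const _))
  have h2 : ∀ s : ℂ, φ (ev P (u + s • v)) = 0 := by
    refine hpf.eq_zero ((real_infinite 0).mono ?_)
    rintro _ ⟨s, hs, rfl⟩
    exact h1 _ (by exact_mod_cast hs.ne')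
  have h3 := gr_deriv (pl P φ) u v 0
  simp only [eval_pl, h2] at h3
  have h4 := h3.unique (hasDerivAt_const 0 0)
  simp only [zero_smul, add_zero, gr_pl] at h4
  simpa [hφ] using h4

theorem exists_immersive {u v : Fin N → ℂ} (huv : LinearIndependent ℂ ![ev P u, ev P v]) :
    ∃ z w, LinearIndependent ℂ ![ev P z, dP P z w] := by
  by_contra hcon
  push Not at hcon
  obtain ⟨Φ, hΦ⟩ := dual_basis huv
  have a00 : Φ 0 (ev P u) = 1 := by simpa using hΦ 0 0
  have a01 : Φ 1 (ev P u) = 0 := by simpa using hΦ 0 1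
  have a10 : Φ 0 (ev P v) = 0 := by simpa using hΦ 1 0
  have a11 : Φ 1 (ev P v) = 1 := by simpa using hΦ 1 1
  set w := v - u
  have hw : ∀ i, PolyFn (fun s : ℂ => (u + s • w) i) := fun i => by
    simp only [Pi.add_apply, Pi.smul_apply, smul_eq_mul]
    exact (PolyFn.const _).add (PolyFn.id.mul (PolyFn.const _))
  obtain ⟨p, hp⟩ := PolyFn.eval (pl P (Φ 0)) hw
  obtain ⟨r, hr⟩ := PolyFn.eval (pl P (Φ 1)) hw
  replace hp : ∀ s : ℂ, eval (u + s • w) (pl P (Φ 0)) = p.eval s := hp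
  replace hr : ∀ s : ℂ, eval (u + s • w) (pl P (Φ 1)) = r.eval s := hr
  have hp' : ∀ s, p.derivative.eval s = Φ 0 (dP P (u + s • w) w) := by
    intro s
    have := gr_deriv (pl P (Φ 0)) u w s
    simp only [hp, gr_pl] at this
    exact (p.hasDerivAt s).unique this
  have hr' : ∀ s, r.derivative.eval s = Φ 1 (dP P (u + s • w) w) := by
    intro s
    have := gr_deriv (pl P (Φ 1)) u w s
    simp only [hr, gr_pl] at this
    exact (r.hasDerivAt s).unique this
  have hW : p * r.derivative = r * p.derivative := by
    refine Polynomial.funext fun s => ?_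
    simp only [Polynomial.eval_mul, hp', hr', ← hp, ← hr, eval_pl]
    have := det_dep (hcon (u + s • w) w) Φ
    rw [det_fin_two] at this
    simp at this
    linear_combination this
  have p0 : p.eval 0 = 1 := by rw [← hp, eval_pl]; simpa using a00
  have p1 : p.eval 1 = 0 := by rw [← hp, eval_pl]; simpa [w] using a10
  have r1 : r.eval 1 = 1 := by rw [← hr, eval_pl]; simpa [w] using a11
  have pne : p ≠ 0 := by rintro rfl; simp at p0
  have rne : r ≠ 0 := by rintro rfl; simp at r1
  have hpd : p.derivative ≠ 0 := by
    intro h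
    have := Polynomial.natDegree_eq_zero_of_derivative_eq_zero h
    rw [Polynomial.eq_C_of_natDegree_eq_zero this] at p0 p1
    simp at p0 p1
    rw [p0] at p1; exact one_ne_zero p1
  have hne : r * p.derivative ≠ 0 := mul_ne_zero rne hpd
  have m1 := Polynomial.rootMultiplicity_mul (x := (1:ℂ)) hne
  have m2 := Polynomial.rootMultiplicity_mul (x := (1:ℂ)) (hW ▸ hne)
  rw [hW, m1] at m2
  have hr0 : r.rootMultiplicity 1 = 0 := Polynomial.rootMultiplicity_eq_zero (by simp [r1])
  have hpp : 0 < p.rootMultiplicity 1 := (Polynomial.rootMultiplicity_pos pne).mpr p1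
  have := Polynomial.derivative_rootMultiplicity_of_root (p := p) (t := (1:ℂ)) p1
  omega

theorem lf_dvd {c c' : Fin N → ℂ} (hc : lf c ≠ 0) (h : lf c ∣ lf c') :
    ∃ r : ℂ, lf c' = C r * lf c := by
  obtain ⟨g, hg⟩ := h
  by_cases h0 : lf c' = 0
  · exact ⟨0, by simp [h0]⟩
  have hg0 : g ≠ 0 := by rintro rfl; exact h0 (by simpa using hg)
  have h1 := totalDegree_mul_of_isDomain hc hg0
  rw [← hg, (lf_hom c).totalDegree hc, (lf_hom c').totalDegree h0] at h1
  have h2 := (totalDegree_eq_zero_iff_eq_C (p := g)).mp (by omega)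
  exact ⟨coeff 0 g, by rw [← h2, mul_comm]; exact hg⟩

theorem lf_prime {c : Fin N → ℂ} (hc : lf c ≠ 0) : Prime (lf c) := by
  rw [← irreducible_iff_prime]
  refine irreducible_of_totalDegree_eq_one ((lf_hom c).totalDegree hc) fun x hx => ?_
  rw [isUnit_iff_ne_zero]
  rintro rfl
  refine hc (MvPolynomial.ext _ _ fun m => ?_)
  simpa using hx m

theorem linear_of_T (hh : ∀ t, (P t).IsHomogeneous d)
    (hcf : ∀ g : MvPolynomial (Fin N) ℂ, (∀ t, g ∣ P t) → g.totalDegree = 0)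
    (hT : ∀ u v, ¬ LinearIndependent ℂ (tri P u v))
    (x : Fin 3 → Fin N → ℂ) (hx : LinearIndependent ℂ fun i => ev P (x i)) : d = 1 := by
  obtain ⟨z, w, hzw⟩ : ∃ z w, LinearIndependent ℂ ![ev P z, dP P z w] := by
    refine exists_immersive (u := x 0) (v := x 1) ?_
    have := hx.comp ![0, 1] (by decide)
    convert this using 1
    ext i; fin_cases i <;> rfl
  obtain ⟨Θ, hΘ⟩ := dual_basis hzw
  set χ := Θ 0
  set ψ := Θ 1
  have hχz : χ (ev P z) = 1 := by simpa using hΘ 0 0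
  have hψz : ψ (ev P z) = 0 := by simpa using hΘ 0 1
  have hψw : ψ (dP P z w) = 1 := by simpa using hΘ 1 1
  set c : ((Fin N' → ℂ) →ₗ[ℂ] ℂ) → Fin N → ℂ := fun φ k => eval z (pderiv k (pl P φ)) with hc
  have hgrc : ∀ φ, gr (pl P φ) z = lf (c φ) := fun φ => rfl
  have hev : ∀ φ v, eval v (lf (c φ)) = φ (dP P z v) := fun φ v => by rw [← hgrc, gr_pl]
  have hLψ : lf (c ψ) ≠ 0 := by
    intro h
    have := hev ψ w
    rw [h, hψw] at this
    simp at this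
  have key : ∀ φ φ' : (Fin N' → ℂ) →ₗ[ℂ] ℂ, φ (ev P z) = 0 → φ' (ev P z) = 0 →
      pl P φ * lf (c φ') = pl P φ' * lf (c φ) := by
    intro φ φ' h1 h2
    refine MvPolynomial.funext fun v => ?_
    have := det3_deriv hh hT ![χ, φ, φ'] z v
    simp only [Matrix.cons_val_zero, Matrix.cons_val_one, Matrix.cons_val, hχz, h1, h2] at this
    simp only [map_mul, hev, eval_pl]
    linear_combination this
  obtain ⟨φ, hφz, hφ⟩ : ∃ φ : (Fin N' → ℂ) →ₗ[ℂ] ℂ, φ (ev P z) = 0 ∧ ¬ (lf (c ψ) ∣ lf (c φ)) := by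
    by_contra hcon
    push Not at hcon
    obtain ⟨Φ, hΦ⟩ := dual_basis hx
    have h1 : ∀ i, ∃ s r : ℂ, ∀ y, Φ i (ev P y) = s * χ (ev P y) + r * ψ (ev P y) := by
      intro i
      set φ' := Φ i - Φ i (ev P z) • χ with hφ'
      have hz : φ' (ev P z) = 0 := by simp [hφ', hχz]
      obtain ⟨r, hr⟩ := lf_dvd hLψ (hcon φ' hz)
      refine ⟨Φ i (ev P z), r, fun y => ?_⟩
      have h2 := key φ' ψ hz hψz
      rw [hr] at h2
      have h3 : pl P φ' = pl P ψ * C r := by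
        apply mul_right_cancel₀ hLψ
        rw [h2]; ring
      have h4 := congrArg (eval y) h3
      simp only [map_mul, eval_pl, eval_C] at h4
      simp only [hφ', LinearMap.sub_apply, LinearMap.smul_apply, smul_eq_mul] at h4
      linear_combination h4
    choose s r hr using h1
    have hdet : (Matrix.of fun i j => Φ i (ev P (x j)) : Matrix (Fin 3) (Fin 3) ℂ).det = 0 := by
      rw [det_fin_three]
      simp only [Matrix.of_apply, hr]
      ring
    have hone : (Matrix.of fun i j => Φ i (ev P (x j)) : Matrix (Fin 3) (Fin 3) ℂ) = 1 := by
      ext i j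
      simp [hΦ, Matrix.one_apply, eq_comm]
    rw [hone] at hdet
    simp at hdet
  have hdvd : lf (c ψ) ∣ pl P ψ := by
    have h1 : lf (c ψ) ∣ pl P ψ * lf (c φ) := ⟨pl P φ, by rw [← key φ ψ hφz hψz]; ring⟩
    exact ((lf_prime hLψ).dvd_or_dvd h1).resolve_right hφ
  obtain ⟨g, hg⟩ := hdvd
  have hgφ : pl P φ = lf (c φ) * g := by
    apply mul_right_cancel₀ hLψ
    rw [key φ ψ hφz hψz, hg]; ring
  have hplψ : pl P ψ ≠ 0 := by
    intro h
    apply hLψ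
    rw [← hgrc, h]
    simp [gr, lf]
  have hg0 : g ≠ 0 := by rintro rfl; exact hplψ (by simpa using hg)
  -- choose u
  obtain ⟨u, hu⟩ : ∃ u, eval u (g * lf (c ψ)) ≠ 0 := by
    by_contra hcon
    push Not at hcon
    exact mul_ne_zero hg0 hLψ (MvPolynomial.funext fun x => by rw [hcon x, map_zero])
  rw [map_mul] at hu
  have hgu := left_ne_zero_of_mul hu
  have hbu := right_ne_zero_of_mul hu
  have hall : ∀ η : (Fin N' → ℂ) →ₗ[ℂ] ℂ, g ∣ pl P η := by
    intro η
    set ℓ := C (eval u (lf (c φ))) * lf (c ψ) - C (eval u (lf (c ψ))) * lf (c φ) with hℓ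
    have hℓ0 : ℓ ≠ 0 := by
      intro h
      apply hφ
      refine ⟨C ((eval u (lf (c ψ)))⁻¹ * eval u (lf (c φ))), ?_⟩
      rw [hℓ, sub_eq_zero] at h
      have h1 := congrArg (fun F => C (eval u (lf (c ψ)))⁻¹ * F) h
      simp only [← mul_assoc, ← C_mul, inv_mul_cancel₀ hbu] at h1
      rw [C_1, one_mul] at h1
      exact h1.symm.trans (mul_comm _ _)
    have hbr : ℓ * (C (eval u (pl P η)) * g * gr g u + C ((eval u g) ^ 2) * pl P η
        - C (eval u g) * g * gr (pl P η) u) = 0 := by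
      refine MvPolynomial.funext fun v => ?_
      have h1 := det3_deriv hh hT ![η, φ, ψ] u v
      simp only [Matrix.cons_val_zero, Matrix.cons_val_one, Matrix.cons_val] at h1
      simp only [← gr_pl, ← eval_pl] at h1
      rw [hg, hgφ] at h1
      simp only [gr_mul, gr_lf, map_mul] at h1
      simp only [hℓ, map_mul, map_add, map_sub, eval_C, map_zero, map_pow]
      linear_combination -h1
    have hbr0 := (mul_eq_zero.mp hbr).resolve_left hℓ0
    refine ⟨C ((eval u g ^ 2)⁻¹) * (C (eval u g) * gr (pl P η) u
      - C (eval u (pl P η)) * gr g u), ?_⟩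
    have h2 : C ((eval u g) ^ 2) * pl P η = g * (C (eval u g) * gr (pl P η) u
      - C (eval u (pl P η)) * gr g u) := by linear_combination hbr0
    have h3 := congrArg (fun F => C ((eval u g ^ 2)⁻¹) * F) h2
    simp only [← mul_assoc, ← C_mul] at h3
    rw [inv_mul_cancel₀ (pow_ne_zero _ hgu), C_1, one_mul] at h3
    exact h3.trans (by ring)
  have hgd : g.totalDegree = 0 := by
    refine hcf g fun t => ?_
    have h1 := hall (LinearMap.proj t)
    have h2 : pl P (LinearMap.proj t) = P t := by
      refine MvPolynomial.funext fun v => ?_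
      rw [eval_pl]; rfl
    rwa [h2] at h1
  have h1 := (pl_hom hh ψ).totalDegree hplψ
  rw [hg, totalDegree_mul_of_isDomain hLψ hg0, hgd, (lf_hom _).totalDegree hLψ] at h1
  exact h1.symm
end L

theorem orth_indep {m n : ℕ} {ι : Type*} {v : ι → Fin (m + n) → ℂ}
    (h1 : ∀ i j, i ≠ j → hm m n (v i) (v j) = 0) (h2 : ∀ i, hm m n (v i) (v i) ≠ 0) :
    LinearIndependent ℂ v := by
  classical
  rw [linearIndependent_iff']
  intro s g hg i hi
  have h3 : hm m n (∑ j ∈ s, g j • v j) (v i) = 0 := by rw [hg]; simp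
  rw [hm_sum_left, Finset.sum_eq_single i] at h3
  · rw [hm_smul_left] at h3
    exact (mul_eq_zero.mp h3).resolve_right (h2 i)
  · intro j _ hj
    rw [hm_smul_left, h1 j i hj, mul_zero]
  · intro h; exact absurd hi h

theorem three_indep {k p n d : ℕ} {P : Fin (k + 3 + 1 + n) → MvPolynomial (Fin (k + 3 + p)) ℂ}
    (hh : ∀ t, (P t).IsHomogeneous d) (hP0 : ∃ t, P t ≠ 0)
    (hO : ∀ z w, 0 < (hm (k + 3) p z z).re → hm (k + 3) p z w = 0 →
      hm (k + 3 + 1) n (ev P w) (ev P z) = 0)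
    (hpos : ∀ z, 0 < (hm (k + 3) p z z).re → ev P z ≠ 0 →
      0 < (hm (k + 3 + 1) n (ev P z) (ev P z)).re) :
    ∃ x : Fin 3 → Fin (k + 3 + p) → ℂ, (∀ i, 0 < (hm (k + 3) p (x i) (x i)).re) ∧
      (∀ i, ev P (x i) ≠ 0) ∧ LinearIndependent ℂ fun i => ev P (x i) := by
  obtain ⟨t0, ht0⟩ := hP0
  obtain ⟨y, hy⟩ : ∃ y, eval y (P t0) ≠ 0 := by
    by_contra hcon
    push Not at hcon
    exact ht0 (MvPolynomial.funext fun x => by rw [hcon x, map_zero])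
  let ix : Fin 3 → Fin (k + 3 + p) := fun i => ⟨i, by omega⟩
  have hixinj : Function.Injective ix := fun i j h => by
    simpa [ix, Fin.ext_iff] using h
  obtain ⟨Q, hQ, hQJ⟩ := generic (m := k + 3) (n := p)
    (Ψ := fun M => ∏ i, eval (M (ix i)) (P t0))
    (PF.prod _ fun i _ M hM => PolyFn.eval _ fun j => hM _ j)
    (by
      intro c M hc hM
      have : ∀ i, eval ((c • M) (ix i)) (P t0) = c ^ d * eval (M (ix i)) (P t0) :=
        fun i => eval_smul_hom (hh t0) c (M (ix i))
      simp only [this]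
      rw [Finset.prod_ne_zero_iff] at hM ⊢
      exact fun i hi => mul_ne_zero (pow_ne_zero _ hc) (hM i hi))
    ⟨fun _ => y, by
      rw [Finset.prod_ne_zero_iff]
      exact fun i _ => hy⟩
  rw [Finset.prod_ne_zero_iff] at hQ
  have hrow : ∀ i j, hm (k + 3) p (Q i) (Q j) = JJ (k + 3) p i j := fun i j => by
    rw [← hm_eq_mul, hQJ]
  have hp : ∀ i : Fin 3, 0 < (hm (k + 3) p (Q (ix i)) (Q (ix i))).re := by
    intro i
    rw [hrow]
    have : (i : ℕ) < k + 3 := by omega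
    simp [JJ, eps, ix, this]
  have hne : ∀ i : Fin 3, ev P (Q (ix i)) ≠ 0 := fun i h =>
    hQ i (Finset.mem_univ _) (congrFun h t0)
  refine ⟨fun i => Q (ix i), hp, hne, orth_indep ?_ ?_⟩
  · intro i j hij
    refine hO _ _ (hp j) ?_
    rw [hrow]
    simp [JJ, hixinj.ne hij.symm]
  · intro i h
    have := hpos _ (hp i) (hne i)
    rw [h] at this
    simp at this

theorem ev_linear {N N' : ℕ} {P : Fin N' → MvPolynomial (Fin N) ℂ}
    (hh : ∀ t, (P t).IsHomogeneous 1) :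
    ∃ L : Matrix (Fin N) (Fin N') ℂ, ∀ x, ev P x = x ᵥ* L := by
  refine ⟨fun k t => eval 0 (pderiv k (P t)), fun x => ?_⟩
  ext t
  have h := gr_deriv (P t) 0 x 0
  simp only [zero_add, zero_smul, eval_smul_hom (hh t), pow_one] at h
  have h2 := h.unique ((hasDerivAt_id (0:ℂ)).mul_const (eval x (P t)))
  rw [one_mul] at h2
  change eval x (P t) = _
  rw [← h2, gr, eval_lf]
  simp only [vecMul, dotProduct]
  exact Finset.sum_congr rfl fun i _ => mul_comm _ _

theorem hm_single {m n : ℕ} (i j : Fin (m + n)) :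
    hm m n (Pi.single i 1) (Pi.single j 1) = if i = j then eps m n i else 0 := by
  simp only [hm, Pi.single_apply]
  split_ifs with h
  · subst h
    rw [Finset.sum_eq_single i] <;> simp +contextual
  · refine Finset.sum_eq_zero fun k _ => ?_
    by_cases h1 : k = i
    · have : k ≠ j := by rw [h1]; exact h
      simp [this]
    · simp [h1]

/-- conformality of the linear map -/
theorem conformal {q p m n : ℕ} {P : Fin (m + n) → MvPolynomial (Fin (q + p)) ℂ}
    {L : Matrix (Fin (q + p)) (Fin (m + n)) ℂ} (hL : ∀ x, ev P x = x ᵥ* L) (hq : 0 < q)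
    (hO : ∀ z w, 0 < (hm q p z z).re → hm q p z w = 0 → hm m n (ev P w) (ev P z) = 0) :
    ∃ κ : ℝ, ∀ w v, hm m n (ev P w) (ev P v) = κ * hm q p w v := by
  have hadd : ∀ x y, ev P (x + y) = ev P x + ev P y := fun x y => by
    simp only [hL, add_vecMul]
  have hsm : ∀ (c : ℂ) x, ev P (c • x) = c • ev P x := fun c x => by
    simp only [hL, smul_vecMul]
  have h1 : ∀ z, 0 < (hm q p z z).re → ∃ κ : ℝ, ∀ w,
      hm m n (ev P w) (ev P z) = κ * hm q p w z := by
    intro z hz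
    refine ⟨(hm m n (ev P z) (ev P z)).re / (hm q p z z).re, fun w => ?_⟩
    have hz0 : hm q p z z ≠ 0 := fun h => by simp [h] at hz
    have h2 := hO z (w + (- (hm q p w z / hm q p z z)) • z) hz (by
      apply hm_symm_zero
      rw [hm_add_left, hm_smul_left]; field_simp; ring)
    rw [hadd, hsm, hm_add_left, hm_smul_left] at h2
    push_cast
    rw [← hm_self, ← hm_self]
    field_simp at h2 ⊢
    linear_combination h2
  set e : Fin (q + p) → ℂ := Pi.single ⟨0, by omega⟩ 1 with he
  have hee : hm q p e e = 1 := by rw [he, hm_single]; simp [eps, hq]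
  obtain ⟨κ, hκ⟩ := h1 e (by rw [hee]; simp)
  refine ⟨κ, fun w v => ?_⟩
  obtain ⟨r, hr1, hr2⟩ : ∃ r : ℝ, 0 < (hm q p (v + (r : ℂ) • e) (v + (r : ℂ) • e)).re ∧
      hm q p (v + (r : ℂ) • e) e ≠ 0 := by
    set a := hm q p v e with ha
    have ha' : hm q p e v = star a := by rw [ha, hm_star]
    set b := (hm q p v v).re with hb
    refine ⟨1 + 2 * |a.re| + |b|, ?_, ?_⟩
    · rw [hm_add_left, hm_add_right, hm_add_right, hm_smul_left, hm_smul_left, hm_smul_right,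
        hm_smul_right, hee, ha', ← ha]
      simp only [Complex.add_re, ← hb, Complex.star_def, Complex.conj_ofReal, Complex.re_ofReal_mul,
        Complex.conj_re, mul_one, Complex.ofReal_re]
      nlinarith [neg_abs_le a.re, neg_abs_le b, abs_nonneg a.re, abs_nonneg b,
        mul_nonneg (abs_nonneg a.re) (abs_nonneg b)]
    · rw [hm_add_left, hm_smul_left, hee, ← ha]
      intro h
      have := congrArg Complex.re h
      simp only [Complex.add_re, mul_one, Complex.ofReal_re, Complex.zero_re] at this
      linarith [neg_abs_le a.re, abs_nonneg a.re, abs_nonneg b]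
  obtain ⟨κ', hκ'⟩ := h1 _ hr1
  have h3 := hκ' e
  have h4 := hκ (v + (r : ℂ) • e)
  have h5 := congrArg star h4
  rw [hm_star, h3, star_mul', hm_star] at h5
  have hne : hm q p e (v + (r : ℂ) • e) ≠ 0 := fun h => hr2 (hm_symm_zero h)
  have h6 := mul_right_cancel₀ hne h5
  have h7 := hκ' w
  rw [h6, hadd, hsm, hm_add_right, hm_add_right, hm_smul_right, hm_smul_right, hκ] at h7
  simp only [Complex.star_def, Complex.conj_ofReal] at h7
  linear_combination h7

theorem hm_comb {m n : ℕ} {ι : Type*} [Fintype ι] [DecidableEq ι] {v : ι → Fin (m + n) → ℂ}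
    {e : ι → ℂ} (h : ∀ i j, hm m n (v i) (v j) = if i = j then e i else 0) (a : ι → ℂ) :
    hm m n (∑ i, a i • v i) (∑ i, a i • v i) = ∑ i, a i * star (a i) * e i := by
  rw [hm_sum_left]
  refine Finset.sum_congr rfl fun i _ => ?_
  rw [hm_smul_left, ← hm_star, hm_sum_left, Finset.sum_eq_single i]
  · rw [hm_smul_left, star_mul', hm_star, h]
    simp; ring
  · intro j _ hj
    rw [hm_smul_left, h, if_neg hj, mul_zero]
  · simp

theorem eps_cases {m n : ℕ} (i : Fin (m + n)) : eps m n i = 1 ∨ eps m n i = -1 := by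
  unfold eps; split_ifs <;> simp

/-- not too many orthonormal vectors of one sign -/
theorem sign_bound {m n : ℕ} (σ : ℝ) (hσ : σ = 1 ∨ σ = -1) {v : Fin (m + n) → Fin (m + n) → ℂ}
    {S : Finset (Fin (m + n))}
    (hv : ∀ i ∈ S, ∀ j ∈ S, hm m n (v i) (v j) = if i = j then eps m n i else 0)
    {x : Fin (m + n) → ℂ} (hx : hm m n x x = σ) (hxv : ∀ i ∈ S, hm m n x (v i) = 0) :
    ∃ i, i ∉ S ∧ eps m n i = σ := by
  classical
  by_contra hcon
  push Not at hcon
  have hS : ∀ i, eps m n i = σ → i ∈ S := fun i hi => by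
    by_contra h; exact hcon i h hi
  let T := {i : Fin (m + n) // eps m n i = σ}
  let w : Option T → Fin (m + n) → ℂ := fun o => o.elim x fun i => v i.1
  have hw : ∀ a b, hm m n (w a) (w b) = if a = b then (σ : ℂ) else 0 := by
    intro a b
    rcases a with _ | a <;> rcases b with _ | b
    · simpa [w] using hx
    · simpa [w] using hxv b (hS _ b.2)
    · simpa [w] using hm_symm_zero (hxv a (hS _ a.2))
    · simp only [w, Option.elim]
      rw [hv _ (hS _ a.2) _ (hS _ b.2)]
      rw [a.2]
      by_cases hab : a = b
      · subst hab; simp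
      · rw [if_neg (fun h => hab (Subtype.ext h)), if_neg (by simpa using hab)]
  let f : (Option T → ℂ) →ₗ[ℂ] (T → ℂ) :=
    (LinearMap.funLeft ℂ ℂ (Subtype.val : T → Fin (m + n))).comp (Fintype.linearCombination ℂ w)
  have hker : LinearMap.ker f ≠ ⊥ := by
    apply LinearMap.ker_ne_bot_of_finrank_lt
    simp
  obtain ⟨a, ha, hane⟩ := (Submodule.ne_bot_iff _).mp hker
  set y := ∑ i, a i • w i with hy
  have hy0 : ∀ i, eps m n i = σ → y i = 0 := by
    intro i hi
    have := congrFun (LinearMap.mem_ker.mp ha) ⟨i, hi⟩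
    simpa [f, LinearMap.funLeft_apply, Fintype.linearCombination_apply, hy] using this
  have h1 := hm_comb hw a
  rw [← hy] at h1
  have hsq : ∀ z : ℂ, z * star z = ((‖z‖ ^ 2 : ℝ) : ℂ) := fun z => by
    rw [Complex.star_def, Complex.mul_conj, Complex.normSq_eq_norm_sq]
  have hσ2 : σ * σ = 1 := by rcases hσ with h | h <;> simp [h]
  have hA : (hm m n y y).re = (∑ i, ‖a i‖ ^ 2) * σ := by
    rw [h1, ← Finset.sum_mul]
    simp only [hsq]
    rw [← Complex.ofReal_sum, ← Complex.ofReal_mul, Complex.ofReal_re]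
  have hB : (hm m n y y).re = - ((∑ i, ‖y i‖ ^ 2) * σ) := by
    have : hm m n y y = ((- ((∑ i, ‖y i‖ ^ 2) * σ) : ℝ) : ℂ) := by
      rw [hm, Finset.sum_mul, ← Finset.sum_neg_distrib, Complex.ofReal_sum]
      refine Finset.sum_congr rfl fun i _ => ?_
      by_cases hi : eps m n i = σ
      · simp [hy0 i hi]
      · have : eps m n i = -σ := by
          rcases eps_cases i with h | h <;> rcases hσ with h' | h' <;> rw [h, h'] at hi <;>
            rw [h, h'] <;> simp at hi ⊢
        rw [this, mul_assoc, hsq]; push_cast; ring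
    rw [this, Complex.ofReal_re]
  have hAp : 0 < ∑ i, ‖a i‖ ^ 2 := by
    obtain ⟨i, hi⟩ := Function.ne_iff.mp hane
    exact Finset.sum_pos' (fun _ _ => by positivity) ⟨i, Finset.mem_univ _, by
      have := norm_pos_iff.mpr hi; positivity⟩
  have hBp : 0 ≤ ∑ i, ‖y i‖ ^ 2 := Finset.sum_nonneg fun _ _ => by positivity
  rw [hA] at hB
  generalize ∑ i, ‖a i‖ ^ 2 = α at *
  generalize ∑ i, ‖y i‖ ^ 2 = β at *
  have h9 : (α + β) * (σ * σ) = 0 := by linear_combination σ * hB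
  rw [hσ2] at h9
  linarith

theorem exists_noniso {m n : ℕ} {v : Fin (m + n) → Fin (m + n) → ℂ}
    {S : Finset (Fin (m + n))} (hS : S ≠ Finset.univ)
    (hv : ∀ i ∈ S, ∀ j ∈ S, hm m n (v i) (v j) = if i = j then eps m n i else 0) :
    ∃ x, hm m n x x ≠ 0 ∧ ∀ i ∈ S, hm m n x (v i) = 0 := by
  classical
  let f : (Fin (m + n) → ℂ) →ₗ[ℂ] (S → ℂ) := LinearMap.pi fun i => hmL (v i)
  have hker : LinearMap.ker f ≠ ⊥ := by
    apply LinearMap.ker_ne_bot_of_finrank_lt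
    simpa using (Finset.card_lt_iff_ne_univ S).mpr hS
  obtain ⟨x, hx, hxne⟩ := (Submodule.ne_bot_iff _).mp hker
  have hxv : ∀ i ∈ S, hm m n x (v i) = 0 := fun i hi =>
    congrFun (LinearMap.mem_ker.mp hx) ⟨i, hi⟩
  set y : Fin (m + n) → ℂ := fun i => eps m n i * x i with hy
  set y' := y - ∑ i ∈ S, (eps m n i * hm m n y (v i)) • v i with hy'
  have hyv : ∀ j ∈ S, hm m n y' (v j) = 0 := by
    intro j hj
    rw [hy', sub_eq_add_neg, hm_add_left, ← neg_one_smul ℂ, hm_smul_left, hm_sum_left,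
      Finset.sum_eq_single_of_mem j hj]
    · rw [hm_smul_left, hv j hj j hj, if_pos rfl]
      linear_combination (- hm m n y (v j)) * eps_mul_self m n j
    · intro i hi hij
      rw [hm_smul_left, hv i hi j hj, if_neg hij, mul_zero]
  have hyx : hm m n y' x = ((nsq x : ℝ) : ℂ) := by
    rw [hy', sub_eq_add_neg, hm_add_left, ← neg_one_smul ℂ, hm_smul_left, hm_sum_left,
      Finset.sum_eq_zero, mul_zero, add_zero, hm, nsq, Complex.ofReal_sum]
    · refine Finset.sum_congr rfl fun i _ => ?_
      have h1 : x i * star (x i) = ((‖x i‖ ^ 2 : ℝ) : ℂ) := by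
        rw [Complex.star_def, Complex.mul_conj, Complex.normSq_eq_norm_sq]
      rw [← h1, hy]
      linear_combination (x i * star (x i)) * eps_mul_self m n i
    · intro i hi
      rw [hm_smul_left, hm_symm_zero (hxv i hi), mul_zero]
  have hxy : hm m n x y' = ((nsq x : ℝ) : ℂ) := by
    rw [← hm_star, hyx]; simp
  by_cases h1 : hm m n x x = 0
  · by_cases h2 : hm m n y' y' = 0
    · refine ⟨x + y', ?_, fun i hi => by rw [hm_add_left, hxv i hi, hyv i hi, add_zero]⟩
      rw [hm_add_left, hm_add_right, hm_add_right, h1, h2, hxy, hyx]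
      have := nsq_pos hxne
      intro h
      have h3 : ((nsq x : ℝ) : ℂ) = 0 := by linear_combination h / 2
      exact this.ne' (by exact_mod_cast h3)
    · exact ⟨y', h2, hyv⟩
  · exact ⟨x, h1, hxv⟩

theorem extend_frame {m n : ℕ} (N : ℕ) : ∀ (S : Finset (Fin (m + n))), Sᶜ.card = N →
    ∀ (v : Fin (m + n) → Fin (m + n) → ℂ),
    (∀ i ∈ S, ∀ j ∈ S, hm m n (v i) (v j) = if i = j then eps m n i else 0) →
    ∃ w : Fin (m + n) → Fin (m + n) → ℂ, (∀ i ∈ S, w i = v i) ∧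
      ∀ i j, hm m n (w i) (w j) = if i = j then eps m n i else 0 := by
  classical
  induction N with
  | zero =>
    intro S hS v hv
    have : S = Finset.univ := by
      rw [Finset.card_eq_zero, Finset.compl_eq_empty_iff] at hS; exact hS
    subst this
    exact ⟨v, fun _ _ => rfl, fun i j => hv i (Finset.mem_univ _) j (Finset.mem_univ _)⟩
  | succ N ih =>
    intro S hS v hv
    have hne : S ≠ Finset.univ := by
      rintro rfl; simp at hS
    obtain ⟨x, hx, hxv⟩ := exists_noniso hne hv
    set r := (hm m n x x).re with hr
    have hxr : hm m n x x = r := hm_self x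
    have hr0 : r ≠ 0 := fun h => hx (by rw [hxr, h]; simp)
    obtain ⟨σ, hσ, hσr⟩ : ∃ σ : ℝ, (σ = 1 ∨ σ = -1) ∧ r = σ * |r| := by
      rcases lt_or_gt_of_ne hr0 with h | h
      · exact ⟨-1, Or.inr rfl, by rw [abs_of_neg h]; ring⟩
      · exact ⟨1, Or.inl rfl, by rw [abs_of_pos h]; ring⟩
    set x' : Fin (m + n) → ℂ := (((Real.sqrt |r|)⁻¹ : ℝ) : ℂ) • x with hx'
    have hsq : Real.sqrt |r| * Real.sqrt |r| = |r| := Real.mul_self_sqrt (abs_nonneg r)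
    have hs0 : Real.sqrt |r| ≠ 0 := by
      intro h; rw [h] at hsq; simp at hsq; exact hr0 (by simpa using hsq.symm)
    have hx1 : hm m n x' x' = σ := by
      rw [hx', hm_smul_left, hm_smul_right, hxr, Complex.star_def, Complex.conj_ofReal,
        ← Complex.ofReal_mul, ← Complex.ofReal_mul]
      congr 1
      have h5 : r = σ * (Real.sqrt |r| * Real.sqrt |r|) := by rw [hsq]; exact hσr
      generalize Real.sqrt |r| = s at *
      rw [h5]
      field_simp
    have hxv' : ∀ i ∈ S, hm m n x' (v i) = 0 := fun i hi => by
      rw [hx', hm_smul_left, hxv i hi, mul_zero]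
    obtain ⟨i0, hi0, hei⟩ := sign_bound σ hσ hv hx1 hxv'
    obtain ⟨w, hw1, hw2⟩ := ih (insert i0 S) (by
      rw [Finset.card_compl, Finset.card_insert_of_notMem hi0] 
      rw [Finset.card_compl] at hS
      omega) (Function.update v i0 x') (by
      intro i hi j hj
      have hne : ∀ k ∈ S, k ≠ i0 := fun k hk h => hi0 (h ▸ hk)
      rcases Finset.mem_insert.mp hi with hi' | hi' <;> rcases Finset.mem_insert.mp hj with hj' | hj'
      · subst hi'; subst hj'; simp [hx1, hei]
      · subst hi'; rw [Function.update_self, Function.update_of_ne (hne j hj'), hxv' j hj',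
          if_neg (hne j hj').symm]
      · subst hj'; rw [Function.update_self, Function.update_of_ne (hne i hi'), hm_symm_zero (hxv' i hi'),
          if_neg (hne i hi')]
      · rw [Function.update_of_ne (hne i hi'), Function.update_of_ne (hne j hj'), hv i hi' j hj'])
    refine ⟨w, fun i hi => ?_, hw2⟩
    rw [hw1 i (Finset.mem_insert_of_mem hi), Function.update_of_ne]
    rintro rfl; exact hi0 hi

/-- position of the coordinates under padding -/
def padIdx (q p p' : ℕ) (hpp : p ≤ p') (i : Fin (q + p)) : Fin (q + 1 + p') :=
  if (i : ℕ) < q then ⟨i, by omega⟩ else ⟨i + 1, by omega⟩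

theorem padIdx_val {q p p' : ℕ} (hpp : p ≤ p') (i : Fin (q + p)) :
    (padIdx q p p' hpp i : ℕ) = if (i : ℕ) < q then (i : ℕ) else i + 1 := by
  unfold padIdx; split_ifs <;> rfl

theorem padIdx_inj {q p p' : ℕ} (hpp : p ≤ p') : Function.Injective (padIdx q p p' hpp) := by
  intro i j h
  have h1 := congrArg Fin.val h
  rw [padIdx_val, padIdx_val] at h1
  apply Fin.ext
  split_ifs at h1 <;> omega

theorem eps_padIdx {q p p' : ℕ} (hpp : p ≤ p') (i : Fin (q + p)) :
    eps (q + 1) p' (padIdx q p p' hpp i) = eps q p i := by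
  unfold eps
  rw [padIdx_val]
  by_cases h : (i : ℕ) < q
  · rw [if_pos h, if_pos h, if_pos (by omega)]
  · rw [if_neg h, if_neg h, if_neg (by omega)]

theorem padSig_padIdx {q p p' : ℕ} (hpp : p ≤ p') (z : Fin (q + p) → ℂ) (i : Fin (q + p)) :
    padSig q p (q + 1) p' z (padIdx q p p' hpp i) = z i := by
  have hv := padIdx_val hpp i
  unfold padSig
  by_cases h : (i : ℕ) < q
  · rw [if_pos h] at hv
    rw [dif_pos (by omega)]
    congr 1; apply Fin.ext; simpa using hv
  · rw [if_neg h] at hv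
    rw [dif_neg (by omega), dif_pos (by omega)]
    congr 1; apply Fin.ext; simp only; omega

theorem padSig_off {q p p' : ℕ} (hpp : p ≤ p') (z : Fin (q + p) → ℂ) (j : Fin (q + 1 + p'))
    (hj : ∀ i, padIdx q p p' hpp i ≠ j) : padSig q p (q + 1) p' z j = 0 := by
  unfold padSig
  split_ifs with h1 h2
  · exact absurd (Fin.ext (by rw [padIdx_val]; simp [h1])) (hj ⟨j, by omega⟩)
  · refine absurd (Fin.ext ?_) (hj ⟨j - 1, by omega⟩)
    rw [padIdx_val, if_neg (by simp only; omega)]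
    simp only; omega
  · rfl

theorem padSig_vecMul {q p p' : ℕ} (hpp : p ≤ p') (z : Fin (q + p) → ℂ)
    (M : Matrix (Fin (q + 1 + p')) (Fin (q + 1 + p')) ℂ) (t : Fin (q + 1 + p')) :
    (padSig q p (q + 1) p' z ᵥ* M) t = ∑ i, z i * M (padIdx q p p' hpp i) t := by
  simp only [vecMul, dotProduct]
  symm
  refine Fintype.sum_of_injective _ (padIdx_inj hpp) _ _ ?_ ?_
  · intro j hj
    rw [padSig_off hpp z j fun i hi => hj ⟨i, hi⟩, zero_mul]
  · intro i
    rw [padSig_padIdx]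

theorem finish {q p p' : ℕ} (hpp : p ≤ p') (L : Matrix (Fin (q + p)) (Fin (q + 1 + p')) ℂ)
    (κ : ℝ) (hκ : 0 < κ) (hL : ∀ i j, hm (q + 1) p' (L i) (L j) =
      κ * (if i = j then eps q p i else 0)) :
    ∃ (M : Matrix (Fin (q + 1 + p')) (Fin (q + 1 + p')) ℂ) (c : ℂ), c ≠ 0 ∧ IsUnit M ∧
      M * JJ (q + 1) p' * Mᴴ = JJ (q + 1) p' ∧
      ∀ z, z ᵥ* L = c • (padSig q p (q + 1) p' z ᵥ* M) := by
  classical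
  set s := Real.sqrt κ with hs
  have hs0 : 0 < s := Real.sqrt_pos.mpr hκ
  have hss : s * s = κ := Real.mul_self_sqrt hκ.le
  have hsC : (s : ℂ) ≠ 0 := by exact_mod_cast hs0.ne'
  let v : Fin (q + 1 + p') → Fin (q + 1 + p') → ℂ :=
    Function.extend (padIdx q p p' hpp) (fun i => ((s⁻¹ : ℝ) : ℂ) • L i) 0
  have hvi : ∀ i, v (padIdx q p p' hpp i) = ((s⁻¹ : ℝ) : ℂ) • L i := fun i =>
    (padIdx_inj hpp).extend_apply _ _ i
  obtain ⟨w, hw1, hw2⟩ := extend_frame (m := q + 1) (n := p') _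
    (Finset.univ.image (padIdx q p p' hpp)) rfl v (by
      intro a ha b hb
      obtain ⟨i, _, rfl⟩ := Finset.mem_image.mp ha
      obtain ⟨j, _, rfl⟩ := Finset.mem_image.mp hb
      rw [hvi, hvi, hm_smul_left, hm_smul_right, hL, Complex.star_def, Complex.conj_ofReal,
        eps_padIdx]
      by_cases hij : i = j
      · have hκC : (κ : ℂ) = s * s := by rw [← hss]; push_cast; ring
        subst hij
        rw [if_pos rfl, if_pos rfl, hκC]
        push_cast
        field_simp
      · rw [if_neg hij, if_neg ((padIdx_inj hpp).ne hij)]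
        simp)
  have hJ : (Matrix.of w) * JJ (q + 1) p' * (Matrix.of w)ᴴ = JJ (q + 1) p' := by
    ext i j
    rw [hm_eq_mul]
    change hm _ _ (w i) (w j) = _
    rw [hw2, JJ, Matrix.diagonal_apply]
  refine ⟨Matrix.of w, s, hsC, ?_, hJ, ?_⟩
  · have h1 : (Matrix.of w) * (JJ (q + 1) p' * (Matrix.of w)ᴴ * JJ (q + 1) p') = 1 := by
      rw [← Matrix.mul_assoc, ← Matrix.mul_assoc, hJ, JJ_sq]
    exact (Matrix.isUnit_iff_isUnit_det _).mpr (Matrix.isUnit_det_of_right_inverse h1)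
  · intro z
    ext t
    rw [Pi.smul_apply, padSig_vecMul hpp, smul_eq_mul, Finset.mul_sum]
    simp only [vecMul, dotProduct]
    refine Finset.sum_congr rfl fun i _ => ?_
    rw [Matrix.of_apply, hw1 _ (Finset.mem_image_of_mem _ (Finset.mem_univ i)), hvi,
      Pi.smul_apply, smul_eq_mul]
    push_cast
    field_simp

theorem main (k p p' : ℕ) (hp : 2 ≤ p) (hpp' : p ≤ p')
    (d : ℕ) (P1 : Fin (k + 3 + 1) → MvPolynomial (Fin (k + 3 + p)) ℂ)
    (P2 : Fin p' → MvPolynomial (Fin (k + 3 + p)) ℂ)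
    (hrep : IsRatProperRep (k + 3) p (k + 3 + 1) p' d P1 P2)
    (hfip : ∀ Z ∈ typeIDomain (k + 3) p, ∃ W ∈ typeIDomain (k + 3 + 1) p',
      ∀ A : Fin (k + 3) → ℂ,
        ¬ ((∀ i, MvPolynomial.eval (Fin.append A (A ᵥ* Z)) (P1 i) = 0) ∧
           (∀ j, MvPolynomial.eval (Fin.append A (A ᵥ* Z)) (P2 j) = 0)) →
        (fun i => MvPolynomial.eval (Fin.append A (A ᵥ* Z)) (P1 i)) ᵥ* W
          = fun j => MvPolynomial.eval (Fin.append A (A ᵥ* Z)) (P2 j)) :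
    d = 1 ∧
    ∃ (M : Matrix (Fin (k + 3 + 1 + p')) (Fin (k + 3 + 1 + p')) ℂ) (c : ℂ), c ≠ 0 ∧ IsUnit M ∧
      M * JJ (k + 3 + 1) p' * Mᴴ = JJ (k + 3 + 1) p' ∧
      ∀ z, ev (Fin.append P1 P2) z = c • (padSig (k + 3) p (k + 3 + 1) p' z ᵥ* M) := by
  obtain ⟨hd, hh1, hh2, hne, hcf, hi, hii⟩ := hrep
  set P := Fin.append P1 P2 with hP
  have hh : ∀ t, (P t).IsHomogeneous d := fun t => by
    refine Fin.addCases (fun i => ?_) (fun i => ?_) t <;> simp [hP, hh1, hh2]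
  have hP1 : ∀ i, P (Fin.castAdd p' i) = P1 i := fun i => by simp [hP]
  have hP2 : ∀ j, P (Fin.natAdd (k + 3 + 1) j) = P2 j := fun j => by simp [hP]
  have hP0 : ∃ t, P t ≠ 0 := by
    by_contra h
    push Not at h
    exact hne ⟨fun i => by rw [← hP1, h], fun j => by rw [← hP2, h]⟩
  have hevs : ∀ z, ev P z = Fin.append (fun i => eval z (P1 i)) (fun j => eval z (P2 j)) := by
    intro z
    rw [← append_split (ev P z)]
    simp only [ev, hP1, hP2]
  have hev0 : ∀ z, (∀ i, eval z (P1 i) = 0) ∧ (∀ j, eval z (P2 j) = 0) → ev P z = 0 := by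
    rintro z ⟨h1, h2⟩
    ext t
    refine Fin.addCases (fun i => ?_) (fun i => ?_) t <;> simp [ev, hP1, hP2, h1, h2]
  have hpos : ∀ z, 0 < (hm (k + 3) p z z).re → ev P z ≠ 0 →
      0 < (hm (k + 3 + 1) p' (ev P z) (ev P z)).re := by
    intro z hz h0
    have := hi (fun i => z (Fin.castAdd p i)) (fun j => z (Fin.natAdd (k + 3) j))
    rw [append_split] at this
    rw [hevs, hm_self_append, sub_pos]
    refine this ?_ fun h => h0 (hev0 z h)
    rw [← append_split z, hm_self_append, sub_pos] at hz
    exact hz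
  have hB : ∀ z, hm (k + 3) p z z = 0 → hm (k + 3 + 1) p' (ev P z) (ev P z) = 0 := by
    intro z hz
    by_cases h0 : (∀ i, eval z (P1 i) = 0) ∧ (∀ j, eval z (P2 j) = 0)
    · rw [hev0 z h0]; simp
    have := hii (fun i => z (Fin.castAdd p i)) (fun j => z (Fin.natAdd (k + 3) j))
    rw [append_split] at this
    rw [hm_self, hevs, hm_self_append, this ?_ ?_ h0, sub_self, Complex.ofReal_zero]
    · rintro ⟨h1, h2⟩
      have hz0 : z = 0 := by
        rw [← append_split z, h1, h2]
        ext t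
        refine Fin.addCases (fun i => ?_) (fun i => ?_) t <;> simp
      have h3 : ∀ t, eval z (P t) = 0 := by
        intro t
        have := eval_smul_hom (hh t) 0 0
        rw [zero_pow (by omega), zero_mul, smul_zero] at this
        rw [hz0, this]
      exact h0 ⟨fun i => by rw [← hP1, h3], fun j => by rw [← hP2, h3]⟩
    · have h4 := congrArg Complex.re hz
      rw [← append_split z, hm_self_append] at h4
      simpa [sub_eq_zero] using h4
  have hO := orth hp hh hB
  have hT := claimT hp hh hP0 (fun E h1 h2 => fibral P1 P2 hfip E h1 h2) hO hpos
  obtain ⟨x, hx1, hx2, hx⟩ := three_indep hh hP0 hO hpos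
  have hd1 : d = 1 := linear_of_T hh (fun g hg => hcf g (fun i => hP1 i ▸ hg _)
    (fun j => hP2 j ▸ hg _)) hT x hx
  subst hd1
  refine ⟨rfl, ?_⟩
  obtain ⟨L, hL⟩ := ev_linear hh
  obtain ⟨κ, hκ⟩ := conformal hL (by omega) hO
  have hκ0 : 0 < κ := by
    have h1 := hpos _ (hx1 0) (hx2 0)
    rw [hκ, Complex.re_ofReal_mul] at h1
    exact (pos_iff_pos_of_mul_pos h1).mpr (hx1 0)
  have hLi : ∀ i, L i = ev P (Pi.single i 1) := fun i => by
    rw [hL, Matrix.single_one_vecMul]; rfl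
  obtain ⟨M, c, h1, h2, h3, h4⟩ := finish hpp' L κ hκ0 (fun i j => by
    rw [hLi, hLi, hκ, hm_single])
  exact ⟨M, c, h1, h2, h3, fun z => by rw [hL, h4]⟩

end FIP

/-- A fibral-image-preserving rational proper map from `D_{q,p}` to `D_{q+1,p'}`
(`3 ≤ q ≤ p - 2`, `p' ≥ p`) is linear: its degree is `1` and, up to generalized unitary
matrices and a nonzero scalar, it is the standard zero-padding map. -/
theorem stmt_17 (q p p' : ℕ) (h0p' : 0 < p') (h3q : 3 ≤ q) (hqp : q ≤ p - 2) (hpp' : p ≤ p')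
    (d : ℕ) (P1 : Fin (q + 1) → MvPolynomial (Fin (q + p)) ℂ)
    (P2 : Fin p' → MvPolynomial (Fin (q + p)) ℂ)
    (hrep : IsRatProperRep q p (q + 1) p' d P1 P2)
    (hfip : ∀ Z ∈ typeIDomain q p, ∃ W ∈ typeIDomain (q + 1) p',
      ∀ A : Fin q → ℂ,
        ¬ ((∀ i, MvPolynomial.eval (Fin.append A (A ᵥ* Z)) (P1 i) = 0) ∧
           (∀ j, MvPolynomial.eval (Fin.append A (A ᵥ* Z)) (P2 j) = 0)) →
        (fun i => MvPolynomial.eval (Fin.append A (A ᵥ* Z)) (P1 i)) ᵥ* W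
          = fun j => MvPolynomial.eval (Fin.append A (A ᵥ* Z)) (P2 j)) :
    d = 1 ∧
    ∃ (Q : Matrix (Fin (q + p)) (Fin (q + p)) ℂ)
      (M : Matrix (Fin ((q + 1) + p')) (Fin ((q + 1) + p')) ℂ) (c : ℂ),
      c ≠ 0 ∧ IsUnit Q ∧ IsUnit M ∧
      Q * sigMatrix q p * Qᴴ = sigMatrix q p ∧
      M * sigMatrix (q + 1) p' * Mᴴ = sigMatrix (q + 1) p' ∧
      ∀ z : Fin (q + p) → ℂ,
        (fun t => MvPolynomial.eval (z ᵥ* Q) (Fin.append P1 P2 t))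
          = c • ((padSig q p (q + 1) p' z) ᵥ* M) := by
  have hS1 : sigMatrix q p = FIP.JJ q p := rfl
  have hS2 : sigMatrix (q + 1) p' = FIP.JJ (q + 1) p' := rfl
  obtain ⟨k, rfl⟩ : ∃ k, q = k + 3 := ⟨q - 3, by omega⟩
  obtain ⟨hd, M, c, h1, h2, h3, h4⟩ := FIP.main k p p' (by omega) hpp' d P1 P2 hrep hfip
  refine ⟨hd, 1, M, c, h1, isUnit_one, h2, by simp, by rw [hS2]; exact h3, fun z => ?_⟩
  rw [Matrix.vecMul_one]
  exact h4 z
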